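/- arXiv:2208.13698 — 7 statements merged into one kernel-verified Lean document; each statement's English description precedes it below -/
import Mathlib

section
/- Let γ(t) = Ψ(u(t), v(t)) be a nondegenerate curve in S₁² with geodesic curvature κ. Then (d/dt)( u'(t) / |γ'(t)| ) = v'(t) cosh(u(t)) · ( κ(t) − v'(t) sinh(u(t)) / |γ'(t)| ). -/
noncomputable section

open Real

/-- Lorentzian inner product on `ℝ³`: `⟨p,q⟩ = p₁q₁ + p₂q₂ − p₃q₃`. -/
def lprod (p q : Fin 3 → ℝ) : ℝ := p 0 * q 0 + p 1 * q 1 - p 2 * q 2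

/-- Determinant of the 3×3 matrix with rows `a`, `b`, `c`. -/
def det3 (a b c : Fin 3 → ℝ) : ℝ :=
  a 0 * (b 1 * c 2 - b 2 * c 1) - a 1 * (b 0 * c 2 - b 2 * c 0)
    + a 2 * (b 0 * c 1 - b 1 * c 0)

/-- Parametrization `Ψ` of the de Sitter plane `S₁² ⊂ L³`. -/
def Psi (u v : ℝ) : Fin 3 → ℝ :=
  ![Real.cosh u * Real.cos v, Real.cosh u * Real.sin v, Real.sinh u]

/-- First derivative of a curve on the de Sitter plane in the coordinates of `Psi`. -/
theorem hasDerivAt_Psi {u v : ℝ → ℝ} {u' v' t : ℝ} (hu : HasDerivAt u u' t)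
    (hv : HasDerivAt v v' t) :
    HasDerivAt (fun τ => Psi (u τ) (v τ))
      ![sinh (u t) * u' * cos (v t) - cosh (u t) * (sin (v t) * v'),
        sinh (u t) * u' * sin (v t) + cosh (u t) * (cos (v t) * v'),
        cosh (u t) * u'] t := by
  rw [hasDerivAt_pi]
  intro i
  fin_cases i
  · simpa [Psi, sub_eq_add_neg] using hu.cosh.fun_mul hv.cos
  · simpa [Psi] using hu.cosh.fun_mul hv.sin
  · simpa [Psi] using hu.sinh

/-- Second derivative of a curve on the de Sitter plane in the coordinates of `Psi`. -/
theorem hasDerivAt_deriv_Psi {u v a b : ℝ → ℝ} {a' b' t : ℝ} (hu : HasDerivAt u (a t) t)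
    (hv : HasDerivAt v (b t) t) (ha : HasDerivAt a a' t) (hb : HasDerivAt b b' t) :
    HasDerivAt (fun τ => ![sinh (u τ) * a τ * cos (v τ) - cosh (u τ) * (sin (v τ) * b τ),
        sinh (u τ) * a τ * sin (v τ) + cosh (u τ) * (cos (v τ) * b τ),
        cosh (u τ) * a τ])
      ![(cosh (u t) * a t ^ 2 + sinh (u t) * a' - cosh (u t) * b t ^ 2) * cos (v t)
          - (2 * sinh (u t) * a t * b t + cosh (u t) * b') * sin (v t),
        (cosh (u t) * a t ^ 2 + sinh (u t) * a' - cosh (u t) * b t ^ 2) * sin (v t)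
          + (2 * sinh (u t) * a t * b t + cosh (u t) * b') * cos (v t),
        sinh (u t) * a t ^ 2 + cosh (u t) * a'] t := by
  rw [hasDerivAt_pi]
  intro i
  fin_cases i
  · refine (((hu.sinh.mul ha).mul hv.cos).sub (hu.cosh.mul (hv.sin.mul hb))).congr_deriv ?_
    simp
    ring
  · refine (((hu.sinh.mul ha).mul hv.sin).add (hu.cosh.mul (hv.cos.mul hb))).congr_deriv ?_
    simp
    ring
  · refine (hu.cosh.mul ha).congr_deriv ?_
    simp
    ring

/-- The determinant `det(γ, γ', γ'')` in the coordinates of `Psi`. -/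
theorem det3_Psi (u v a b a' b' : ℝ) :
    det3 (Psi u v)
      ![sinh u * a * cos v - cosh u * (sin v * b), sinh u * a * sin v + cosh u * (cos v * b),
        cosh u * a]
      ![(cosh u * a ^ 2 + sinh u * a' - cosh u * b ^ 2) * cos v
          - (2 * sinh u * a * b + cosh u * b') * sin v,
        (cosh u * a ^ 2 + sinh u * a' - cosh u * b ^ 2) * sin v
          + (2 * sinh u * a * b + cosh u * b') * cos v,
        sinh u * a ^ 2 + cosh u * a']
      = cosh u * b * a' - 2 * sinh u * a ^ 2 * b - cosh u * a * b'
        + sinh u * cosh u ^ 2 * b ^ 3 := by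
  have hv := sin_sq_add_cos_sq v
  have hu := cosh_sq u
  simp only [det3, Psi, Matrix.cons_val_zero, Matrix.cons_val_one, Matrix.cons_val]
  generalize cosh u = c, sinh u = s, cos v = C, sin v = S at *
  have hS : S ^ 2 = 1 - C ^ 2 := by linarith
  have hs : s ^ 2 = c ^ 2 - 1 := by linarith
  grind

theorem deriv_u_over_speed
    (u v : ℝ → ℝ) (hu : ContDiff ℝ (⊤ : ℕ∞) u) (hv : ContDiff ℝ (⊤ : ℕ∞) v)
    (ε : ℝ) (hε : ε = 1 ∨ ε = -1)
    (γ : ℝ → Fin 3 → ℝ) (hγ : ∀ t, γ t = Psi (u t) (v t))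
    (sp : ℝ → ℝ)
    (hsp : ∀ t, sp t =
      Real.sqrt (ε * ((deriv v t) ^ 2 * Real.cosh (u t) ^ 2 - (deriv u t) ^ 2)))
    (hnd : ∀ t, 0 < ε * ((deriv v t) ^ 2 * Real.cosh (u t) ^ 2 - (deriv u t) ^ 2))
    (κ : ℝ → ℝ)
    (hκ : ∀ t, κ t = ε * det3 (γ t) (deriv γ t) (deriv (deriv γ) t) / sp t ^ 3)
    :
    ∀ t, deriv (fun τ => deriv u τ / sp τ) t
      = deriv v t * Real.cosh (u t) * (κ t - deriv v t * Real.sinh (u t) / sp t) := by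
  intro t
  have hu1 : ∀ τ, HasDerivAt u (deriv u τ) τ := fun τ =>
    (hu.differentiable (by simp)).differentiableAt.hasDerivAt
  have hv1 : ∀ τ, HasDerivAt v (deriv v τ) τ := fun τ =>
    (hv.differentiable (by simp)).differentiableAt.hasDerivAt
  have hu2 : HasDerivAt (deriv u) (deriv (deriv u) t) t :=
    ((contDiff_infty_iff_deriv.1 hu).2.differentiable (by simp)).differentiableAt.hasDerivAt
  have hv2 : HasDerivAt (deriv v) (deriv (deriv v) t) t :=
    ((contDiff_infty_iff_deriv.1 hv).2.differentiable (by simp)).differentiableAt.hasDerivAt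
  have hγ1 := funext fun τ => (hasDerivAt_Psi (hu1 τ) (hv1 τ)).deriv
  rw [← funext hγ] at hγ1
  have hκt := hκ t
  rw [hγ1, (hasDerivAt_deriv_Psi (hu1 t) (hv1 t) hu2 hv2).deriv, hγ t, det3_Psi] at hκt
  have hpos : 0 < sp t := by
    rw [hsp]
    exact sqrt_pos.2 (hnd t)
  have hsq : sp t ^ 2 = ε * (deriv v t ^ 2 * cosh (u t) ^ 2 - deriv u t ^ 2) := by
    rw [hsp, sq_sqrt (hnd t).le]
  have hsp' : HasDerivAt sp (ε * (deriv v t * deriv (deriv v) t * cosh (u t) ^ 2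
      + deriv v t ^ 2 * cosh (u t) * sinh (u t) * deriv u t
      - deriv u t * deriv (deriv u) t) / sp t) t := by
    have h := ((((hv2.pow 2).mul ((hu1 t).cosh.pow 2)).sub (hu2.pow 2)).const_mul ε).sqrt
      (hnd t).ne'
    rw [funext hsp]
    refine h.congr_deriv ?_
    simp only [Pi.mul_apply, Pi.sub_apply, Pi.pow_apply]
    rw [← hsp t]
    field_simp
    ring
  rw [(hu2.fun_div hsp' hpos.ne').deriv, hκt]
  field_simp
  rw [hsq]
  ring
end
end

section
/- Let γ(t) = Ψ(u(t), v(t)) be a nondegenerate curve in S₁² with geodesic curvature κ. Then (d/dt)( v'(t) cosh(u(t)) / |γ'(t)| ) = u'(t) · ( κ(t) − v'(t) sinh(u(t)) / |γ'(t)| ). -/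
noncomputable section

open Real

/-- Velocity of `Psi (u t) (v t)` when `u` and `v` have derivatives `a` and `b`. -/
def PsiVelocity (u v a b : ℝ) : Fin 3 → ℝ :=
  ![Real.sinh u * a * Real.cos v - Real.cosh u * (Real.sin v * b),
    Real.sinh u * a * Real.sin v + Real.cosh u * (Real.cos v * b),
    Real.cosh u * a]

/-- Acceleration of `Psi (u t) (v t)` when `u` and `v` have first derivatives `a`, `b` and
second derivatives `c`, `d`. -/
def PsiAcceleration (u v a b c d : ℝ) : Fin 3 → ℝ :=
  ![(Real.sinh u * c + Real.cosh u * (a ^ 2 - b ^ 2)) * Real.cos v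
      - (2 * Real.sinh u * a * b + Real.cosh u * d) * Real.sin v,
    (Real.sinh u * c + Real.cosh u * (a ^ 2 - b ^ 2)) * Real.sin v
      + (2 * Real.sinh u * a * b + Real.cosh u * d) * Real.cos v,
    Real.cosh u * c + Real.sinh u * a ^ 2]

theorem hasDerivAt_Psi_s2 {u v : ℝ → ℝ} {a b t : ℝ} (hu : HasDerivAt u a t)
    (hv : HasDerivAt v b t) :
    HasDerivAt (fun s => Psi (u s) (v s)) (PsiVelocity (u t) (v t) a b) t := by
  rw [hasDerivAt_pi]
  intro i
  fin_cases i
  · refine (hu.cosh.mul hv.cos).congr_deriv ?_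
    simp [PsiVelocity]
    ring
  · exact hu.cosh.mul hv.sin
  · exact hu.sinh

theorem hasDerivAt_PsiVelocity {u v a b : ℝ → ℝ} {c d t : ℝ} (hu : HasDerivAt u (a t) t)
    (hv : HasDerivAt v (b t) t) (ha : HasDerivAt a c t) (hb : HasDerivAt b d t) :
    HasDerivAt (fun s => PsiVelocity (u s) (v s) (a s) (b s))
      (PsiAcceleration (u t) (v t) (a t) (b t) c d) t := by
  rw [hasDerivAt_pi]
  intro i
  fin_cases i
  · refine (((hu.sinh.mul ha).mul hv.cos).sub (hu.cosh.mul (hv.sin.mul hb))).congr_deriv ?_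
    simp [PsiAcceleration]
    ring
  · refine (((hu.sinh.mul ha).mul hv.sin).add (hu.cosh.mul (hv.cos.mul hb))).congr_deriv ?_
    simp [PsiAcceleration]
    ring
  · refine (hu.cosh.mul ha).congr_deriv ?_
    simp [PsiAcceleration]
    ring

theorem det3_Psi_frame (u v a b c d : ℝ) :
    det3 (Psi u v) (PsiVelocity u v a b) (PsiAcceleration u v a b c d)
      = Real.cosh u * (b * c - a * d) - 2 * Real.sinh u * a ^ 2 * b
        + Real.cosh u ^ 2 * Real.sinh u * b ^ 3 := by
  have hc := Real.cos_sq' v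
  have hh := Real.cosh_sq u
  simp only [det3, Psi, PsiVelocity, PsiAcceleration, Matrix.cons_val]
  grind


theorem deriv_v_cosh_over_speed
    (u v : ℝ → ℝ) (hu : ContDiff ℝ (⊤ : ℕ∞) u) (hv : ContDiff ℝ (⊤ : ℕ∞) v)
    (ε : ℝ) (hε : ε = 1 ∨ ε = -1)
    (γ : ℝ → Fin 3 → ℝ) (hγ : ∀ t, γ t = Psi (u t) (v t))
    (sp : ℝ → ℝ)
    (hsp : ∀ t, sp t =
      Real.sqrt (ε * ((deriv v t) ^ 2 * Real.cosh (u t) ^ 2 - (deriv u t) ^ 2)))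
    (hnd : ∀ t, 0 < ε * ((deriv v t) ^ 2 * Real.cosh (u t) ^ 2 - (deriv u t) ^ 2))
    (κ : ℝ → ℝ)
    (hκ : ∀ t, κ t = ε * det3 (γ t) (deriv γ t) (deriv (deriv γ) t) / sp t ^ 3)
    :
    ∀ t, deriv (fun τ => deriv v τ * Real.cosh (u τ) / sp τ) t
      = deriv u t * (κ t - deriv v t * Real.sinh (u t) / sp t) := by
  have hu1 : ∀ t, HasDerivAt u (deriv u t) t := fun t =>
    (hu.differentiable (by simp) t).hasDerivAt
  have hv1 : ∀ t, HasDerivAt v (deriv v t) t := fun t =>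
    (hv.differentiable (by simp) t).hasDerivAt
  have hu2 : ∀ t, HasDerivAt (deriv u) (deriv (deriv u) t) t := fun t =>
    ((contDiff_infty_iff_deriv.1 hu).2.differentiable (by simp) t).hasDerivAt
  have hv2 : ∀ t, HasDerivAt (deriv v) (deriv (deriv v) t) t := fun t =>
    ((contDiff_infty_iff_deriv.1 hv).2.differentiable (by simp) t).hasDerivAt
  intro t
  have hγ1 : deriv γ = fun s => PsiVelocity (u s) (v s) (deriv u s) (deriv v s) := by
    rw [funext hγ]
    exact funext fun s => (hasDerivAt_Psi_s2 (hu1 s) (hv1 s)).deriv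
  have hγ2 := (hasDerivAt_PsiVelocity (hu1 t) (hv1 t) (hu2 t) (hv2 t)).deriv
  have hdet := det3_Psi_frame (u t) (v t) (deriv u t) (deriv v t)
    (deriv (deriv u) t) (deriv (deriv v) t)
  have hpos : 0 < sp t := by rw [hsp]; exact Real.sqrt_pos.2 (hnd t)
  have hsq : sp t ^ 2 = ε * ((deriv v t) ^ 2 * Real.cosh (u t) ^ 2 - (deriv u t) ^ 2) := by
    rw [hsp]; exact Real.sq_sqrt (hnd t).le
  have hw := (hv2 t).mul (hu1 t).cosh
  have hsp1 : HasDerivAt sp (ε * (deriv v t * Real.cosh (u t) *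
      (deriv (deriv v) t * Real.cosh (u t) + deriv v t * (Real.sinh (u t) * deriv u t))
      - deriv u t * deriv (deriv u) t) / sp t) t := by
    rw [show sp = _ from funext hsp]
    refine ((((((hv2 t).pow 2).mul ((hu1 t).cosh.pow 2)).sub ((hu2 t).pow 2)).const_mul
      ε).sqrt (hnd t).ne').congr_deriv ?_
    simp only [Pi.mul_apply, Pi.pow_apply, Pi.sub_apply]
    rw [← hsp]
    field_simp
    push_cast
    ring
  have hderiv : deriv (fun τ => deriv v τ * Real.cosh (u τ) / sp τ) t = _ :=
    (hw.div hsp1 hpos.ne').deriv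
  rw [hderiv, hκ, hγ, hγ1, hγ2, hdet]
  simp only [Pi.mul_apply]
  field_simp
  linear_combination (deriv (deriv v) t * Real.cosh (u t)
    + 2 * deriv u t * deriv v t * Real.sinh (u t)) * hsq
end
end

section
/- (First fundamental form and unit normal of the spherical rotational surface.) Let u : ℝ → ℝ be smooth with ε(cosh(u(t))² − u'(t)²) > 0, |γ'(t)| = √(ε(cosh(u)² − u'²)), and define r(t,s) = (cosh(u(t)) cos t, cosh(u(t)) sin t, cosh(s) sinh(u(t)), sinh(s) sinh(u(t))) and N(t,s) = (1/|γ'(t)|) · ( cos(t) sinh(u) cosh(u) − u' sin(t), u' cos(t) + sin(t) sinh(u) cosh(u), cosh(s) cosh(u)², sinh(s) cosh(u)² ). Then for all (t,s): B(r_t, r_s) = 0, B(r_t, r_t) = cosh(u)² − u'², B(r_s, r_s) = sinh(u)², and N satisfies B(N, r) = B(N, r_t) = B(N, r_s) = 0 and B(N, N) = −ε. -/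
noncomputable section

open Real

/-- Lorentzian inner product on `ℝ⁴`: `B(p,q) = p₁q₁ + p₂q₂ − p₃q₃ + p₄q₄`. -/
def B4 (p q : Fin 4 → ℝ) : ℝ := p 0 * q 0 + p 1 * q 1 - p 2 * q 2 + p 3 * q 3

theorem spherical_surface_fundamental_data
    (u : ℝ → ℝ) (hu : ContDiff ℝ (⊤ : ℕ∞) u)
    (ε : ℝ) (hε : ε = 1 ∨ ε = -1)
    (sp : ℝ → ℝ)
    (hsp : ∀ t, sp t = Real.sqrt (ε * (Real.cosh (u t) ^ 2 - (deriv u t) ^ 2)))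
    (hnd : ∀ t, 0 < ε * (Real.cosh (u t) ^ 2 - (deriv u t) ^ 2))
    (r : ℝ → ℝ → Fin 4 → ℝ)
    (hr : ∀ t s, r t s = ![Real.cosh (u t) * Real.cos t, Real.cosh (u t) * Real.sin t,
      Real.cosh s * Real.sinh (u t), Real.sinh s * Real.sinh (u t)])
    (N : ℝ → ℝ → Fin 4 → ℝ)
    (hN : ∀ t s, N t s = (1 / sp t) •
      ![Real.cos t * Real.sinh (u t) * Real.cosh (u t) - deriv u t * Real.sin t,
        deriv u t * Real.cos t + Real.sin t * Real.sinh (u t) * Real.cosh (u t),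
        Real.cosh s * Real.cosh (u t) ^ 2, Real.sinh s * Real.cosh (u t) ^ 2])
    :
    ∀ t s : ℝ,
      B4 (deriv (fun τ => r τ s) t) (deriv (r t) s) = 0 ∧
      B4 (deriv (fun τ => r τ s) t) (deriv (fun τ => r τ s) t)
        = Real.cosh (u t) ^ 2 - (deriv u t) ^ 2 ∧
      B4 (deriv (r t) s) (deriv (r t) s) = Real.sinh (u t) ^ 2 ∧
      B4 (N t s) (r t s) = 0 ∧
      B4 (N t s) (deriv (fun τ => r τ s) t) = 0 ∧
      B4 (N t s) (deriv (r t) s) = 0 ∧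
      B4 (N t s) (N t s) = -ε := by
  intro t s
  have hud : HasDerivAt u (deriv u t) t :=
    (hu.differentiable (by simp)).differentiableAt.hasDerivAt
  have hrt : deriv (fun τ => r τ s) t =
      ![Real.sinh (u t) * deriv u t * Real.cos t - Real.cosh (u t) * Real.sin t,
        Real.sinh (u t) * deriv u t * Real.sin t + Real.cosh (u t) * Real.cos t,
        Real.cosh s * (Real.cosh (u t) * deriv u t),
        Real.sinh s * (Real.cosh (u t) * deriv u t)] := by
    apply HasDerivAt.deriv
    simp only [hr]
    rw [hasDerivAt_pi]
    intro i
    fin_cases i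
    · refine (hud.cosh.mul (Real.hasDerivAt_cos t)).congr_deriv ?_
      change _ = Real.sinh (u t) * deriv u t * Real.cos t - Real.cosh (u t) * Real.sin t
      ring
    · exact hud.cosh.mul (Real.hasDerivAt_sin t)
    · exact hud.sinh.const_mul (Real.cosh s)
    · exact hud.sinh.const_mul (Real.sinh s)
  have hrs : deriv (r t) s =
      ![0, 0, Real.sinh s * Real.sinh (u t), Real.cosh s * Real.sinh (u t)] := by
    apply HasDerivAt.deriv
    rw [funext (hr t), hasDerivAt_pi]
    intro i
    fin_cases i
    · exact hasDerivAt_const s _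
    · exact hasDerivAt_const s _
    · exact (Real.hasDerivAt_cosh s).mul_const _
    · exact (Real.hasDerivAt_sinh s).mul_const _
  have hsp_sq : sp t ^ 2 = ε * (Real.cosh (u t) ^ 2 - (deriv u t) ^ 2) := by
    rw [hsp, Real.sq_sqrt (hnd t).le]
  have hsp_ne : sp t ≠ 0 := by
    rw [hsp]
    exact (Real.sqrt_pos.mpr (hnd t)).ne'
  have hε_sq : ε ^ 2 = 1 := by
    rcases hε with rfl | rfl <;> norm_num
  have hs := Real.cosh_sq s
  have hut := Real.cosh_sq (u t)
  have ht := Real.sin_sq_add_cos_sq t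
  rw [hrt, hrs, hr, hN]
  simp only [B4, Pi.smul_apply, smul_eq_mul, Matrix.cons_val]
  generalize Real.cosh (u t) = c at *
  generalize Real.sinh (u t) = d at *
  generalize Real.cosh s = a at *
  generalize Real.sinh s = b at *
  generalize Real.sin t = y at *
  generalize Real.cos t = x at *
  generalize deriv u t = v at *
  generalize sp t = w at *
  refine ⟨by ring, ?_, ?_, ?_, ?_, by ring, ?_⟩
  · linear_combination (d ^ 2 * v ^ 2 + c ^ 2) * ht - c ^ 2 * v ^ 2 * hs - v ^ 2 * hut
  · linear_combination d ^ 2 * hs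
  · linear_combination (1 / w) * (c ^ 2 * d * ht - c ^ 2 * d * hs)
  · linear_combination (1 / w) * ((d ^ 2 * c * v + c * v) * ht - c ^ 3 * v * hs - c * v * hut)
  · have key : (x * d * c - v * y) ^ 2 + (v * x + y * d * c) ^ 2 - (a * c ^ 2) ^ 2
        + (b * c ^ 2) ^ 2 = -ε * w ^ 2 := by
      linear_combination (d ^ 2 * c ^ 2 + v ^ 2) * ht - c ^ 4 * hs - c ^ 2 * hut
        + ε * hsp_sq + (c ^ 2 - v ^ 2) * hε_sq
    field_simp
    linear_combination key
end
end

section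
/- (Mean curvature identity for the spherical rotational surface.) Let u : ℝ → ℝ be smooth with ε(cosh(u(t))² − u'(t)²) > 0 and |γ'(t)| = √(ε(cosh(u)² − u'²)), let γ(t) = Ψ(u(t), t) with geodesic curvature κ(t), and define r(t,s) = (cosh(u) cos t, cosh(u) sin t, cosh(s) sinh(u), sinh(s) sinh(u)), N(t,s) = (1/|γ'|) · ( cos(t) sinh(u) cosh(u) − u' sin(t), u' cos(t) + sin(t) sinh(u) cosh(u), cosh(s) cosh(u)², sinh(s) cosh(u)² ), E = B(r_t,r_t), G = B(r_s,r_s), h₁₁ = B(N, r_tt), h₂₂ = B(N, r_ss). Then for all (t,s): E·h₂₂ + G·h₁₁ = −ε · sinh(u(t)) · |γ'(t)| · ( cosh(u(t))² + κ(t) · sinh(u(t)) · |γ'(t)| ). -/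
noncomputable section

open Real

/-- A curve in `ℝ³` given by its coordinates is differentiated coordinatewise. -/
theorem HasDerivAt.vec3 {f₀ f₁ f₂ : ℝ → ℝ} {a₀ a₁ a₂ t : ℝ} (h₀ : HasDerivAt f₀ a₀ t)
    (h₁ : HasDerivAt f₁ a₁ t) (h₂ : HasDerivAt f₂ a₂ t) :
    HasDerivAt (fun x => ![f₀ x, f₁ x, f₂ x]) ![a₀, a₁, a₂] t := by
  rw [hasDerivAt_pi]
  intro i
  fin_cases i <;> assumption

/-- A curve in `ℝ⁴` given by its coordinates is differentiated coordinatewise. -/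
theorem HasDerivAt.vec4 {f₀ f₁ f₂ f₃ : ℝ → ℝ} {a₀ a₁ a₂ a₃ t : ℝ} (h₀ : HasDerivAt f₀ a₀ t)
    (h₁ : HasDerivAt f₁ a₁ t) (h₂ : HasDerivAt f₂ a₂ t) (h₃ : HasDerivAt f₃ a₃ t) :
    HasDerivAt (fun x => ![f₀ x, f₁ x, f₂ x, f₃ x]) ![a₀, a₁, a₂, a₃] t := by
  rw [hasDerivAt_pi]
  intro i
  fin_cases i <;> assumption

theorem spherical_surface_mean_curvature_identity
    (u : ℝ → ℝ) (hu : ContDiff ℝ (⊤ : ℕ∞) u)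
    (ε : ℝ) (hε : ε = 1 ∨ ε = -1)
    (sp : ℝ → ℝ)
    (hsp : ∀ t, sp t = Real.sqrt (ε * (Real.cosh (u t) ^ 2 - (deriv u t) ^ 2)))
    (hnd : ∀ t, 0 < ε * (Real.cosh (u t) ^ 2 - (deriv u t) ^ 2))
    (γ : ℝ → Fin 3 → ℝ) (hγ : ∀ t, γ t = Psi (u t) t)
    (κ : ℝ → ℝ)
    (hκ : ∀ t, κ t = ε * det3 (γ t) (deriv γ t) (deriv (deriv γ) t) / sp t ^ 3)
    (r : ℝ → ℝ → Fin 4 → ℝ)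
    (hr : ∀ t s, r t s = ![Real.cosh (u t) * Real.cos t, Real.cosh (u t) * Real.sin t,
      Real.cosh s * Real.sinh (u t), Real.sinh s * Real.sinh (u t)])
    (N : ℝ → ℝ → Fin 4 → ℝ)
    (hN : ∀ t s, N t s = (1 / sp t) •
      ![Real.cos t * Real.sinh (u t) * Real.cosh (u t) - deriv u t * Real.sin t,
        deriv u t * Real.cos t + Real.sin t * Real.sinh (u t) * Real.cosh (u t),
        Real.cosh s * Real.cosh (u t) ^ 2, Real.sinh s * Real.cosh (u t) ^ 2])
    :
    ∀ t s : ℝ,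
      B4 (deriv (fun τ => r τ s) t) (deriv (fun τ => r τ s) t)
          * B4 (N t s) (deriv (deriv (r t)) s)
        + B4 (deriv (r t) s) (deriv (r t) s)
          * B4 (N t s) (deriv (deriv (fun τ => r τ s)) t)
      = -ε * Real.sinh (u t) * sp t
          * (Real.cosh (u t) ^ 2 + κ t * Real.sinh (u t) * sp t) := by
  intro t s
  have hu0 (x : ℝ) : HasDerivAt u (deriv u x) x :=
    (hu.differentiable (by simp) x).hasDerivAt
  have hu1 (x : ℝ) : HasDerivAt (deriv u) (deriv (deriv u) x) x :=
    ((contDiff_infty_iff_deriv.1 hu).2.differentiable (by simp) x).hasDerivAt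
  set w := deriv u
  set a := deriv w
  have hC (x : ℝ) : HasDerivAt (fun x => cosh (u x)) (sinh (u x) * w x) x := (hu0 x).cosh
  have hS (x : ℝ) : HasDerivAt (fun x => sinh (u x)) (cosh (u x) * w x) x := (hu0 x).sinh
  have hx (x : ℝ) : HasDerivAt (fun x => cosh (u x) * cos x)
      (sinh (u x) * w x * cos x + cosh (u x) * -sin x) x := (hC x).mul (hasDerivAt_cos x)
  have hy (x : ℝ) : HasDerivAt (fun x => cosh (u x) * sin x)
      (sinh (u x) * w x * sin x + cosh (u x) * cos x) x := (hC x).mul (hasDerivAt_sin x)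
  have hCw (x : ℝ) : HasDerivAt (fun x => cosh (u x) * w x)
      (sinh (u x) * w x * w x + cosh (u x) * a x) x := (hC x).mul (hu1 x)
  have hSw (x : ℝ) : HasDerivAt (fun x => sinh (u x) * w x)
      (cosh (u x) * w x * w x + sinh (u x) * a x) x := (hS x).mul (hu1 x)
  have hx' := ((hSw t).mul (hasDerivAt_cos t)).add ((hC t).mul (hasDerivAt_sin t).neg)
  have hy' := ((hSw t).mul (hasDerivAt_sin t)).add ((hC t).mul (hasDerivAt_cos t))
  have hγ_eq : γ = fun x => ![cosh (u x) * cos x, cosh (u x) * sin x, sinh (u x)] := funext hγ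
  have hγ_deriv := funext fun x => ((hx x).vec3 (hy x) (hS x)).deriv
  have hγ_deriv2 := (hx'.vec3 hy' (hCw t)).deriv
  have hrt_eq : (fun τ => r τ s) = fun x => ![cosh (u x) * cos x, cosh (u x) * sin x,
      cosh s * sinh (u x), sinh s * sinh (u x)] := funext fun x => hr x s
  have hrt_deriv := funext fun x =>
    ((hx x).vec4 (hy x) ((hS x).const_mul (cosh s)) ((hS x).const_mul (sinh s))).deriv
  have hrt_deriv2 :=
    (hx'.vec4 hy' ((hCw t).const_mul (cosh s)) ((hCw t).const_mul (sinh s))).deriv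
  have hrs_eq : r t = fun y => ![cosh (u t) * cos t, cosh (u t) * sin t,
      cosh y * sinh (u t), sinh y * sinh (u t)] := funext fun y => hr t y
  have hrs_deriv := funext fun y =>
    ((hasDerivAt_const y (cosh (u t) * cos t)).vec4 (hasDerivAt_const y (cosh (u t) * sin t))
      ((hasDerivAt_cosh y).mul_const (sinh (u t)))
      ((hasDerivAt_sinh y).mul_const (sinh (u t)))).deriv
  have hrs_deriv2 :=
    ((hasDerivAt_const s (0 : ℝ)).vec4 (hasDerivAt_const s (0 : ℝ))
      ((hasDerivAt_sinh s).mul_const (sinh (u t)))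
      ((hasDerivAt_cosh s).mul_const (sinh (u t)))).deriv
  have hsp_pos : 0 < sp t := hsp t ▸ sqrt_pos.2 (hnd t)
  have hsp_sq : sp t ^ 2 = ε * (cosh (u t) ^ 2 - w t ^ 2) := by
    rw [hsp t, sq_sqrt (hnd t).le]
  have hεε : ε * ε = 1 := by rcases hε with rfl | rfl <;> norm_num
  have hcs : cosh s ^ 2 = sinh s ^ 2 + 1 := cosh_sq s
  have hcu : cosh (u t) ^ 2 = sinh (u t) ^ 2 + 1 := cosh_sq (u t)
  have hsc : sin t ^ 2 = 1 - cos t ^ 2 := sin_sq t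
  have hE : B4 (deriv (fun τ => r τ s) t) (deriv (fun τ => r τ s) t) = ε * sp t ^ 2 := by
    rw [hrt_eq, hrt_deriv, hsp_sq]
    simp only [B4, Matrix.cons_val]
    grind
  have hG : B4 (deriv (r t) s) (deriv (r t) s) = sinh (u t) ^ 2 := by
    rw [hrs_eq, hrs_deriv]
    simp only [B4, Matrix.cons_val]
    grind
  have h22 : sp t * B4 (N t s) (deriv (deriv (r t)) s) = -(cosh (u t) ^ 2 * sinh (u t)) := by
    rw [hrs_eq, hrs_deriv, hrs_deriv2, hN]
    simp only [B4, Pi.smul_apply, smul_eq_mul, Matrix.cons_val]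
    field_simp
    grind
  have h11 : sp t * B4 (N t s) (deriv (deriv (fun τ => r τ s)) t) =
      -det3 (γ t) (deriv γ t) (deriv (deriv γ) t) := by
    rw [hrt_eq, hrt_deriv, hN, hγ_eq, hγ_deriv]
    erw [hrt_deriv2, hγ_deriv2]
    simp only [B4, det3, Pi.smul_apply, smul_eq_mul, Matrix.cons_val]
    field_simp
    grind
  have hκ' : κ t * sp t ^ 3 = ε * det3 (γ t) (deriv γ t) (deriv (deriv γ) t) := by
    rw [hκ t]
    field_simp
  rw [hE, hG]
  apply mul_left_cancel₀ hsp_pos.ne'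
  linear_combination ε * sp t ^ 2 * h22 + sinh (u t) ^ 2 * h11 + ε * sinh (u t) ^ 2 * hκ'
    + sinh (u t) ^ 2 * det3 (γ t) (deriv γ t) (deriv (deriv γ) t) * hεε
end
end

section
/- (Spherical rotational minimal surfaces.) Let u : ℝ → ℝ be smooth on [a,b] with u(t) > 0 and ε(cosh(u(t))² − u'(t)²) > 0, |γ'(t)| = √(ε(cosh(u)² − u'²)), let γ(t) = Ψ(u(t), t) with geodesic curvature κ, and let r(t,s) = (cosh(u(t)) cos t, cosh(u(t)) sin t, cosh(s) sinh(u(t)), sinh(s) sinh(u(t))) be the associated rotational surface of spherical type in S₁³. Then r is minimal if and only if κ(t) = − cosh(u(t))² / ( sinh(u(t)) · |γ'(t)| ) for all t ∈ [a,b], i.e. if and only if γ satisfies the catenary equation with respect to the plane {z = 0} with Lagrange multiplier λ = 0. -/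
noncomputable section

open Real

theorem hasDerivAt_vec3 {f g h : ℝ → ℝ} {f' g' h' x : ℝ} (hf : HasDerivAt f f' x)
    (hg : HasDerivAt g g' x) (hh : HasDerivAt h h' x) :
    HasDerivAt (fun t => ![f t, g t, h t]) ![f', g', h'] x := by
  rw [hasDerivAt_pi]
  intro i
  fin_cases i <;> simpa

theorem hasDerivAt_vec4 {f g h k : ℝ → ℝ} {f' g' h' k' x : ℝ} (hf : HasDerivAt f f' x)
    (hg : HasDerivAt g g' x) (hh : HasDerivAt h h' x) (hk : HasDerivAt k k' x) :
    HasDerivAt (fun t => ![f t, g t, h t, k t]) ![f', g', h', k'] x := by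
  rw [hasDerivAt_pi]
  intro i
  fin_cases i <;> simpa

theorem hasDerivAt_cosh_comp_mul_cos {u : ℝ → ℝ} {p t : ℝ} (h : HasDerivAt u p t) :
    HasDerivAt (fun t => cosh (u t) * cos t)
      (sinh (u t) * p * cos t - cosh (u t) * sin t) t :=
  (h.cosh.mul (hasDerivAt_cos t)).congr_deriv (by ring)

theorem hasDerivAt_cosh_comp_mul_sin {u : ℝ → ℝ} {p t : ℝ} (h : HasDerivAt u p t) :
    HasDerivAt (fun t => cosh (u t) * sin t)
      (sinh (u t) * p * sin t + cosh (u t) * cos t) t :=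
  h.cosh.mul (hasDerivAt_sin t)

theorem hasDerivAt_deriv_cosh_comp_mul_cos {u v : ℝ → ℝ} {q t : ℝ} (h : HasDerivAt u (v t) t)
    (h' : HasDerivAt v q t) :
    HasDerivAt (fun t => sinh (u t) * v t * cos t - cosh (u t) * sin t)
      ((cosh (u t) * v t ^ 2 + sinh (u t) * q - cosh (u t)) * cos t
        - 2 * sinh (u t) * v t * sin t) t :=
  (((h.sinh.mul h').mul (hasDerivAt_cos t)).sub (h.cosh.mul (hasDerivAt_sin t))).congr_deriv
    (by simp only [Pi.mul_apply]; ring)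

theorem hasDerivAt_deriv_cosh_comp_mul_sin {u v : ℝ → ℝ} {q t : ℝ} (h : HasDerivAt u (v t) t)
    (h' : HasDerivAt v q t) :
    HasDerivAt (fun t => sinh (u t) * v t * sin t + cosh (u t) * cos t)
      ((cosh (u t) * v t ^ 2 + sinh (u t) * q - cosh (u t)) * sin t
        + 2 * sinh (u t) * v t * cos t) t :=
  (((h.sinh.mul h').mul (hasDerivAt_sin t)).add (h.cosh.mul (hasDerivAt_cos t))).congr_deriv
    (by simp only [Pi.mul_apply]; ring)

theorem hasDerivAt_deriv_sinh_comp {u v : ℝ → ℝ} {q t : ℝ} (h : HasDerivAt u (v t) t)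
    (h' : HasDerivAt v q t) :
    HasDerivAt (fun t => cosh (u t) * v t)
      (sinh (u t) * v t ^ 2 + cosh (u t) * q) t :=
  (h.cosh.mul h').congr_deriv (by ring)

/-- The curvature equation of the profile curve, with denominators cleared. -/
theorem curvature_eq_iff {ε w S C p q D : ℝ} (hε : ε = 1 ∨ ε = -1) (hw : 0 < w) (hS : 0 < S)
    (hw2 : w ^ 2 = ε * (C ^ 2 - p ^ 2))
    (hD : D = C * q - 2 * S * p ^ 2 + C ^ 2 * S) :
    ε * D / w ^ 3 = -C ^ 2 / (S * w) ↔
      C * S * q - 2 * S ^ 2 * p ^ 2 + C ^ 2 * S ^ 2 + C ^ 2 * (C ^ 2 - p ^ 2) = 0 := by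
  have hε2 : ε * ε = 1 := by rcases hε with rfl | rfl <;> norm_num
  subst hD
  rw [div_eq_div_iff (by positivity) (by positivity)]
  constructor
  · intro h
    have h1 : w * (C * S * q - 2 * S ^ 2 * p ^ 2 + C ^ 2 * S ^ 2 + C ^ 2 * (C ^ 2 - p ^ 2)) = 0 := by
      linear_combination ε * h - w * ε * C ^ 2 * hw2 -
        w * (C * S * q - 2 * S ^ 2 * p ^ 2 + C ^ 2 * S ^ 2 + C ^ 2 * (C ^ 2 - p ^ 2)) * hε2
    exact (mul_eq_zero.mp h1).resolve_left hw.ne'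
  · intro h
    linear_combination w * ε * h + w * C ^ 2 * hw2

theorem spherical_rotational_minimal
    (a b : ℝ) (hab : a < b)
    (u : ℝ → ℝ) (hu : ContDiff ℝ (⊤ : ℕ∞) u)
    (ε : ℝ) (hε : ε = 1 ∨ ε = -1)
    (sp : ℝ → ℝ)
    (hsp : ∀ t, sp t = Real.sqrt (ε * (Real.cosh (u t) ^ 2 - (deriv u t) ^ 2)))
    (hpos : ∀ t ∈ Set.Icc a b, 0 < u t)
    (hnd : ∀ t ∈ Set.Icc a b, 0 < ε * (Real.cosh (u t) ^ 2 - (deriv u t) ^ 2))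
    (γ : ℝ → Fin 3 → ℝ) (hγ : ∀ t, γ t = Psi (u t) t)
    (κ : ℝ → ℝ)
    (hκ : ∀ t, κ t = ε * det3 (γ t) (deriv γ t) (deriv (deriv γ) t) / sp t ^ 3)
    (r : ℝ → ℝ → Fin 4 → ℝ)
    (hr : ∀ t s, r t s = ![Real.cosh (u t) * Real.cos t, Real.cosh (u t) * Real.sin t,
      Real.cosh s * Real.sinh (u t), Real.sinh s * Real.sinh (u t)])
    :
    ((∀ t ∈ Set.Icc a b, ∀ s : ℝ, ∀ N : Fin 4 → ℝ,
        B4 N (r t s) = 0 → B4 N (deriv (fun τ => r τ s) t) = 0 →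
          B4 N (deriv (r t) s) = 0 →
        B4 (deriv (fun τ => r τ s) t) (deriv (fun τ => r τ s) t)
            * B4 N (deriv (deriv (r t)) s)
          - 2 * B4 (deriv (fun τ => r τ s) t) (deriv (r t) s)
            * B4 N (deriv (fun σ => deriv (fun τ => r τ σ) t) s)
          + B4 (deriv (r t) s) (deriv (r t) s)
            * B4 N (deriv (deriv (fun τ => r τ s)) t) = 0)
      ↔ (∀ t ∈ Set.Icc a b, κ t = -Real.cosh (u t) ^ 2 / (Real.sinh (u t) * sp t))) := by
  have hu1 : ∀ t, HasDerivAt u (deriv u t) t := fun t =>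
    (hu.differentiable (by simp)).differentiableAt.hasDerivAt
  have hu2 : ∀ t, HasDerivAt (deriv u) (deriv (deriv u) t) t := fun t =>
    ((contDiff_infty_iff_deriv.mp hu).2.differentiable (by simp)).differentiableAt.hasDerivAt
  obtain rfl : γ = fun t => ![cosh (u t) * cos t, cosh (u t) * sin t, sinh (u t)] := funext hγ
  obtain rfl : r = fun t s => ![cosh (u t) * cos t, cosh (u t) * sin t,
      cosh s * sinh (u t), sinh s * sinh (u t)] := funext fun t => funext (hr t)
  have hγ1 : deriv (fun t => ![cosh (u t) * cos t, cosh (u t) * sin t, sinh (u t)]) =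
      fun t => ![sinh (u t) * deriv u t * cos t - cosh (u t) * sin t,
        sinh (u t) * deriv u t * sin t + cosh (u t) * cos t, cosh (u t) * deriv u t] :=
    funext fun t => (hasDerivAt_vec3 (hasDerivAt_cosh_comp_mul_cos (hu1 t))
      (hasDerivAt_cosh_comp_mul_sin (hu1 t)) (hu1 t).sinh).deriv
  have hγ2 := fun t => (hasDerivAt_vec3 (hasDerivAt_deriv_cosh_comp_mul_cos (hu1 t) (hu2 t))
    (hasDerivAt_deriv_cosh_comp_mul_sin (hu1 t) (hu2 t))
    (hasDerivAt_deriv_sinh_comp (hu1 t) (hu2 t))).deriv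
  have hrt : ∀ s, deriv (fun t => ![cosh (u t) * cos t, cosh (u t) * sin t,
      cosh s * sinh (u t), sinh s * sinh (u t)]) =
      fun t => ![sinh (u t) * deriv u t * cos t - cosh (u t) * sin t,
        sinh (u t) * deriv u t * sin t + cosh (u t) * cos t,
        cosh s * (cosh (u t) * deriv u t), sinh s * (cosh (u t) * deriv u t)] := fun s =>
    funext fun t => (hasDerivAt_vec4 (hasDerivAt_cosh_comp_mul_cos (hu1 t))
      (hasDerivAt_cosh_comp_mul_sin (hu1 t)) ((hu1 t).sinh.const_mul _)
      ((hu1 t).sinh.const_mul _)).deriv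
  have hrtt := fun s t => (hasDerivAt_vec4 (hasDerivAt_deriv_cosh_comp_mul_cos (hu1 t) (hu2 t))
    (hasDerivAt_deriv_cosh_comp_mul_sin (hu1 t) (hu2 t))
    ((hasDerivAt_deriv_sinh_comp (hu1 t) (hu2 t)).const_mul (cosh s))
    ((hasDerivAt_deriv_sinh_comp (hu1 t) (hu2 t)).const_mul (sinh s))).deriv
  have hrs : ∀ x y z : ℝ, deriv (fun s => ![x, y, cosh s * z, sinh s * z]) =
      fun s => ![0, 0, sinh s * z, cosh s * z] := fun x y z => funext fun s =>
    (hasDerivAt_vec4 (hasDerivAt_const s x) (hasDerivAt_const s y)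
      ((hasDerivAt_cosh s).mul_const z) ((hasDerivAt_sinh s).mul_const z)).deriv
  have hrss : ∀ x y z : ℝ, deriv (fun s => ![x, y, sinh s * z, cosh s * z]) =
      fun s => ![0, 0, cosh s * z, sinh s * z] := fun x y z => funext fun s =>
    (hasDerivAt_vec4 (hasDerivAt_const s x) (hasDerivAt_const s y)
      ((hasDerivAt_sinh s).mul_const z) ((hasDerivAt_cosh s).mul_const z)).deriv
  refine forall₂_congr fun t ht => ?_
  have hS : 0 < sinh (u t) := sinh_pos_iff.mpr (hpos t ht)
  have hC : 0 < cosh (u t) := cosh_pos _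
  have hCS : cosh (u t) ^ 2 = sinh (u t) ^ 2 + 1 := cosh_sq _
  have htrig : sin t ^ 2 + cos t ^ 2 = 1 := sin_sq_add_cos_sq t
  have hw : 0 < sp t := by rw [hsp]; exact sqrt_pos.mpr (hnd t ht)
  have hw2 : sp t ^ 2 = ε * (cosh (u t) ^ 2 - deriv u t ^ 2) := by
    rw [hsp, sq_sqrt (hnd t ht).le]
  rw [hκ, hγ1, hγ2, curvature_eq_iff (q := deriv (deriv u) t) hε hw hS hw2]
  · simp only [hrt, hrtt, hrs, hrss, B4, Matrix.cons_val]
    generalize deriv (deriv u) t = q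
    generalize deriv u t = p at *
    generalize cosh (u t) = C at *
    generalize sinh (u t) = S at *
    generalize sin t = y at *
    generalize cos t = x at *
    constructor
    · intro h
      have hN := h 0 ![C * S * x - p * y, C * S * y + p * x, C ^ 2, 0]
      simp only [Matrix.cons_val, cosh_zero, sinh_zero] at hN
      specialize hN (by linear_combination C ^ 2 * S * htrig)
        (by linear_combination C * p * (S ^ 2 + 1) * htrig - C * p * hCS) (by ring)
      have hSK : S * (C * S * q - 2 * S ^ 2 * p ^ 2 + C ^ 2 * S ^ 2 +
          C ^ 2 * (C ^ 2 - p ^ 2)) = 0 := by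
        linear_combination -hN + (C * S ^ 3 * (C * p ^ 2 + S * q - C) + 2 * S ^ 3 * p ^ 2
          - C ^ 2 * S * (S ^ 2 * p ^ 2 + C ^ 2)) * htrig + (C ^ 2 * S * p ^ 2 - C * S ^ 2 * q) * hCS
      exact (mul_eq_zero.mp hSK).resolve_left hS.ne'
    · intro h s N h1 h2 h3
      have hch : cosh s ^ 2 = sinh s ^ 2 + 1 := cosh_sq s
      generalize cosh s = c at *
      generalize sinh s = d at *
      obtain ⟨n₁, hn₁⟩ : ∃ n, n = N 0 * x + N 1 * y := ⟨_, rfl⟩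
      obtain ⟨n₂, hn₂⟩ : ∃ n, n = N 1 * x - N 0 * y := ⟨_, rfl⟩
      obtain ⟨n₃, hn₃⟩ : ∃ n, n = N 3 * d - N 2 * c := ⟨_, rfl⟩
      have e1 : C * n₁ + S * n₃ = 0 := by
        subst hn₁ hn₃
        linear_combination h1
      have e2 : S * p * n₁ + C * n₂ + C * p * n₃ = 0 := by
        subst hn₁ hn₂ hn₃
        linear_combination h2
      have hE : (S * p * x - C * y) * (S * p * x - C * y)
          + (S * p * y + C * x) * (S * p * y + C * x)
          - c * (C * p) * (c * (C * p)) + d * (C * p) * (d * (C * p)) = C ^ 2 - p ^ 2 := by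
        linear_combination (S ^ 2 * p ^ 2 + C ^ 2) * htrig - C ^ 2 * p ^ 2 * hch - p ^ 2 * hCS
      have hG : (0 : ℝ) * 0 + 0 * 0 - d * S * (d * S) + c * S * (c * S) = S ^ 2 := by
        linear_combination S ^ 2 * hch
      have hM : (C ^ 2 - p ^ 2) * (S * n₃) + S ^ 2 * ((C * p ^ 2 + S * q - C) * n₁
          + 2 * S * p * n₂ + (S * p ^ 2 + C * q) * n₃) = 0 := by
        refine (mul_eq_zero.mp ?_).resolve_left (mul_pos hC hC).ne'
        linear_combination n₃ * S * h
          + (C * S ^ 2 * (C * p ^ 2 + S * q - C) - 2 * S ^ 4 * p ^ 2) * e1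
          + 2 * S ^ 3 * p * C * e2 + n₃ * (S ^ 2 * C * q - 2 * S ^ 3 * p ^ 2) * hCS
      rw [hE, hG]
      subst hn₁ hn₂ hn₃
      linear_combination hM
  · simp only [det3, Matrix.cons_val]
    generalize deriv (deriv u) t = q
    generalize deriv u t = p at *
    generalize cosh (u t) = C at *
    generalize sinh (u t) = S at *
    generalize sin t = y at *
    generalize cos t = x at *
    linear_combination (C * (S * p ^ 2 + C * q) * C - 2 * C ^ 2 * S * p ^ 2
      + 2 * S ^ 3 * p ^ 2 - C * S * (C * p ^ 2 + S * q - C)) * htrig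
      + (C * q - 2 * S * p ^ 2) * hCS
end
end

section
/- (Hyperbolic case.) Let γ(t) = Ψ(u(t), v(t)) be a nondegenerate curve on [a,b] with cosh(u(t)) sin(v(t)) > 0 and cosh(u(t)) sin(v(t)) + λ ≠ 0 for all t. Then γ is a critical point of the energy with density ρ(u,v) = cosh(u) sin(v) + λ (a catenary with respect to the timelike plane {y = 0}) if and only if its geodesic curvature satisfies κ(t) = − ( u'(t) cos(v(t)) + v'(t) sinh(u(t)) cosh(u(t)) sin(v(t)) ) / ( (cosh(u(t)) sin(v(t)) + λ) · |γ'(t)| ) for all t ∈ [a,b]. -/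
noncomputable section

open Real

/-- The curve `t ↦ Ψ(u t, v t)`, restricted to `[a, b]`, is a critical point of the
energy `E[γ] = ∫ₐᵇ ρ(u(t), v(t)) |γ'(t)| dt` among variations fixing the endpoints. -/
def IsCritical (ρ : ℝ → ℝ → ℝ) (ε : ℝ) (u v : ℝ → ℝ) (a b : ℝ) : Prop :=
  ∀ φ ψ : ℝ → ℝ, ContDiff ℝ (⊤ : ℕ∞) φ → ContDiff ℝ (⊤ : ℕ∞) ψ →
    φ a = 0 → φ b = 0 → ψ a = 0 → ψ b = 0 →
    deriv (fun s : ℝ => ∫ t in a..b,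
      ρ (u t + s * φ t) (v t + s * ψ t) *
        Real.sqrt (ε * ((deriv v t + s * deriv ψ t) ^ 2 *
          Real.cosh (u t + s * φ t) ^ 2 - (deriv u t + s * deriv φ t) ^ 2))) 0 = 0

/-- Differentiation under the integral sign for an integrand that is `C¹` in the parameter on an
open neighbourhood of `{0} × [a, b]`. -/
lemma hasDerivAt_intervalIntegral_of_continuousOn {F F' : ℝ → ℝ → ℝ} {a b : ℝ} (hab : a ≤ b)
    {U : Set (ℝ × ℝ)} (hU : IsOpen U) (hmem : ∀ t ∈ Set.Icc a b, ((0 : ℝ), t) ∈ U)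
    (hF : ContinuousOn (fun p : ℝ × ℝ => F p.1 p.2) U)
    (hF' : ContinuousOn (fun p : ℝ × ℝ => F' p.1 p.2) U)
    (hd : ∀ s t, (s, t) ∈ U → HasDerivAt (fun x => F x t) (F' s t) s) :
    HasDerivAt (fun s => ∫ t in a..b, F s t) (∫ t in a..b, F' 0 t) 0 := by
  obtain ⟨V, W, hV, -, h0V, hW, hVW⟩ := generalized_tube_lemma (isCompact_singleton (x := (0 : ℝ)))
    (isCompact_Icc (a := a) (b := b)) hU (by
      rintro ⟨s, t⟩ ⟨hs, ht⟩
      obtain rfl : s = 0 := hs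
      exact hmem t ht)
  obtain ⟨δ, hδ, hball⟩ := Metric.nhds_basis_closedBall.mem_iff.mp
    (hV.mem_nhds (h0V rfl))
  have hsub : Metric.closedBall (0 : ℝ) δ ×ˢ Set.Icc a b ⊆ U :=
    (Set.prod_mono hball hW).trans hVW
  have hslice : ∀ G : ℝ → ℝ → ℝ, ContinuousOn (fun p : ℝ × ℝ => G p.1 p.2) U →
      ∀ s ∈ Metric.closedBall (0 : ℝ) δ, ContinuousOn (G s) (Set.Icc a b) := fun G hG s hs =>
    hG.comp (f := fun t : ℝ => (s, t)) (by fun_prop) fun t ht => hsub ⟨hs, ht⟩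
  have hIoc : Set.uIoc a b ⊆ Set.Icc a b := by
    rw [Set.uIoc_of_le hab]
    exact Set.Ioc_subset_Icc_self
  have hmeas : ∀ G : ℝ → ℝ → ℝ, ContinuousOn (fun p : ℝ × ℝ => G p.1 p.2) U →
      ∀ s ∈ Metric.closedBall (0 : ℝ) δ, MeasureTheory.AEStronglyMeasurable (G s)
        (MeasureTheory.volume.restrict (Set.uIoc a b)) := fun G hG s hs =>
    ((hslice G hG s hs).mono hIoc).aestronglyMeasurable measurableSet_uIoc
  have h0 : (0 : ℝ) ∈ Metric.closedBall (0 : ℝ) δ := Metric.mem_closedBall_self hδ.le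
  obtain ⟨C, hC⟩ := ((isCompact_closedBall (0 : ℝ) δ).prod
    (isCompact_Icc (a := a) (b := b))).exists_bound_of_continuousOn (hF'.mono hsub)
  refine (intervalIntegral.hasDerivAt_integral_of_dominated_loc_of_deriv_le
    (bound := fun _ => C) (Metric.closedBall_mem_nhds (0 : ℝ) hδ) ?_ ?_ (hmeas F' hF' 0 h0)
    ?_ intervalIntegrable_const ?_).2
  · filter_upwards [Metric.closedBall_mem_nhds (0 : ℝ) hδ] with s hs using hmeas F hF s hs
  · exact ContinuousOn.intervalIntegrable_of_Icc hab (hslice F hF 0 h0)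
  · exact .of_forall fun t ht s hs => hC (s, t) ⟨hs, hIoc ht⟩
  · exact .of_forall fun t ht s hs => hd s t (hsub ⟨hs, hIoc ht⟩)

/-- The fundamental lemma of the calculus of variations on a compact interval. -/
lemma eqOn_zero_of_integral_mul_smooth_eq_zero {f : ℝ → ℝ} {a b : ℝ} (hab : a < b)
    (hf : ContinuousOn f (Set.Icc a b))
    (h : ∀ g : ℝ → ℝ, ContDiff ℝ (⊤ : ℕ∞) g → g a = 0 → g b = 0 →
      ∫ t in a..b, f t * g t = 0) :
    ∀ t ∈ Set.Icc a b, f t = 0 := by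
  have hae := isOpen_Ioo.ae_eq_zero_of_integral_contDiff_smul_eq_zero (U := Set.Ioo a b)
    (μ := MeasureTheory.volume)
    ((hf.mono Set.Ioo_subset_Icc_self).locallyIntegrableOn measurableSet_Ioo) (fun g hg _ hsupp => by
      have hz : ∀ t, t ∉ Set.Ioo a b → g t = 0 := fun t ht =>
        image_eq_zero_of_notMem_tsupport fun ht' => ht (hsupp ht')
      have hint := h g hg (hz a (by simp)) (hz b (by simp))
      rw [intervalIntegral.integral_of_le hab.le, MeasureTheory.integral_Ioc_eq_integral_Ioo,
        MeasureTheory.setIntegral_eq_integral_of_forall_compl_eq_zero] at hint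
      · simpa [mul_comm] using hint
      · intro t ht
        simp [hz t ht])
  have hIcc : f =ᵐ[MeasureTheory.volume.restrict (Set.Icc a b)] fun _ => 0 := by
    rw [← MeasureTheory.Measure.restrict_congr_set MeasureTheory.Ioo_ae_eq_Icc]
    exact (MeasureTheory.ae_restrict_iff' measurableSet_Ioo).mpr hae
  exact MeasureTheory.Measure.eqOn_Icc_of_ae_eq _ hab.ne hIcc hf continuousOn_const

/-- Integration by parts against a test function vanishing at the endpoints. -/
lemma integral_add_mul_deriv_eq {A P P' φ : ℝ → ℝ} {a b : ℝ} (hab : a ≤ b)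
    (hA : ContinuousOn A (Set.Icc a b)) (hP : ∀ t ∈ Set.Icc a b, HasDerivAt P (P' t) t)
    (hP' : ContinuousOn P' (Set.Icc a b)) (hφ : ContDiff ℝ (⊤ : ℕ∞) φ)
    (ha : φ a = 0) (hb : φ b = 0) :
    ∫ t in a..b, (A t * φ t + P t * deriv φ t) = ∫ t in a..b, (A t - P' t) * φ t := by
  have hφ' : Continuous (deriv φ) := hφ.continuous_deriv (by simp)
  have hφc : Continuous φ := hφ.continuous
  have hPc : ContinuousOn P (Set.Icc a b) := HasDerivAt.continuousOn hP
  have hparts := intervalIntegral.integral_mul_deriv_eq_deriv_mul (a := a) (b := b) (u := P)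
    (u' := P') (v := φ) (v' := deriv φ) (by rwa [Set.uIcc_of_le hab])
    (fun t _ => (hφ.differentiable (by simp) t).hasDerivAt)
    (ContinuousOn.intervalIntegrable_of_Icc hab hP') (hφ'.intervalIntegrable _ _)
  simp only [ha, hb, mul_zero, sub_zero, zero_sub] at hparts
  have hAφ : IntervalIntegrable (fun t => A t * φ t) MeasureTheory.volume a b :=
    ContinuousOn.intervalIntegrable_of_Icc hab (hA.mul hφc.continuousOn)
  rw [intervalIntegral.integral_add (g := fun t => P t * deriv φ t) hAφ
    (ContinuousOn.intervalIntegrable_of_Icc hab (hPc.mul hφ'.continuousOn)), hparts,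
    ← sub_eq_add_neg, ← intervalIntegral.integral_sub (g := fun t => P' t * φ t) hAφ
    (ContinuousOn.intervalIntegrable_of_Icc hab (hP'.mul hφc.continuousOn))]
  simp only [sub_mul]

/-- The squared speed `ε ⟨γ', γ'⟩` of `Ψ(u, v)` at a point with velocity `(u', v')`. -/
def sqSpeed (ε u u' v' : ℝ) : ℝ := ε * (v' ^ 2 * cosh u ^ 2 - u' ^ 2)

/-- The derivative of `sqSpeed` in the direction `(x, x', y')`. -/
def sqSpeedDeriv (ε u u' v' x x' y' : ℝ) : ℝ :=
  ε * (2 * v' * y' * cosh u ^ 2 + v' ^ 2 * (2 * cosh u * sinh u * x) - 2 * u' * x')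

lemma hasDerivAt_sqSpeed {ε : ℝ} {u u' v' : ℝ → ℝ} {x x' y' s : ℝ} (hu : HasDerivAt u x s)
    (hu' : HasDerivAt u' x' s) (hv' : HasDerivAt v' y' s) :
    HasDerivAt (fun s => sqSpeed ε (u s) (u' s) (v' s))
      (sqSpeedDeriv ε (u s) (u' s) (v' s) x x' y') s := by
  refine ((((hv'.pow 2).mul (hu.cosh.pow 2)).sub (hu'.pow 2)).const_mul ε).congr_deriv ?_
  simp only [sqSpeedDeriv, Pi.pow_apply]
  push_cast
  ring

/-- The density `cosh u sin v + lam`. -/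
def density (lam u v : ℝ) : ℝ := cosh u * sin v + lam

/-- The derivative of `density` in the direction `(x, y)`. -/
def densityDeriv (u v x y : ℝ) : ℝ := sinh u * x * sin v + cosh u * (cos v * y)

lemma hasDerivAt_density {lam : ℝ} {u v : ℝ → ℝ} {x y s : ℝ} (hu : HasDerivAt u x s)
    (hv : HasDerivAt v y s) :
    HasDerivAt (fun s => density lam (u s) (v s)) (densityDeriv (u s) (v s) x y) s :=
  ((hu.cosh.mul hv.sin).add_const lam).congr_deriv (by simp only [densityDeriv])

/-- The derivative of a momentum `R X / √W`. -/
lemma hasDerivAt_momentum {R X W : ℝ → ℝ} {R' X' W' t : ℝ} (hR : HasDerivAt R R' t)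
    (hX : HasDerivAt X X' t) (hW : HasDerivAt W W' t) (hpos : 0 < W t) :
    HasDerivAt (fun t => R t * X t / √(W t))
      ((R' * X t + R t * X') / √(W t) - R t * X t * W' / (2 * √(W t) ^ 3)) t := by
  have hs : √(W t) ≠ 0 := (Real.sqrt_pos.mpr hpos).ne'
  refine ((hR.mul hX).div (hW.sqrt hpos.ne') hs).congr_deriv ?_
  simp only [Pi.mul_apply]
  field_simp

/-- The left-hand side of the Euler–Lagrange equation for the coordinate `u`. -/
def eulerU (lam ε u u₁ u₂ v v₁ v₂ : ℝ) : ℝ :=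
  sinh u * sin v * √(sqSpeed ε u u₁ v₁)
    + density lam u v * (ε * v₁ ^ 2 * cosh u * sinh u) / √(sqSpeed ε u u₁ v₁)
    - ((densityDeriv u v u₁ v₁ * (-ε * u₁) + density lam u v * (-ε * u₂)) / √(sqSpeed ε u u₁ v₁)
      - density lam u v * (-ε * u₁) * sqSpeedDeriv ε u u₁ v₁ u₁ u₂ v₂
        / (2 * √(sqSpeed ε u u₁ v₁) ^ 3))

/-- The left-hand side of the Euler–Lagrange equation for the coordinate `v`. -/
def eulerV (lam ε u u₁ u₂ v v₁ v₂ : ℝ) : ℝ :=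
  cosh u * cos v * √(sqSpeed ε u u₁ v₁)
    - ((densityDeriv u v u₁ v₁ * (ε * v₁ * cosh u ^ 2)
        + density lam u v * (ε * v₂ * cosh u ^ 2 + ε * v₁ * (2 * cosh u * sinh u * u₁)))
          / √(sqSpeed ε u u₁ v₁)
      - density lam u v * (ε * v₁ * cosh u ^ 2) * sqSpeedDeriv ε u u₁ v₁ u₁ u₂ v₂
        / (2 * √(sqSpeed ε u u₁ v₁) ^ 3))

/-- The determinant `det (γ, γ', γ'')` divided by `cosh u`. -/
def reducedDet (u u₁ u₂ v₁ v₂ : ℝ) : ℝ :=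
  v₁ * u₂ - u₁ * v₂ + v₁ ^ 3 * cosh u * sinh u - 2 * u₁ ^ 2 * v₁ * (sinh u / cosh u)

/-- The normal component of the Euler–Lagrange equations. -/
def eulerNormal (lam ε u u₁ u₂ v v₁ v₂ : ℝ) : ℝ :=
  ε * sqSpeed ε u u₁ v₁ * (u₁ * cos v + v₁ * sinh u * cosh u * sin v)
    + density lam u v * (cosh u * reducedDet u u₁ u₂ v₁ v₂)

lemma eulerU_mul {lam ε u u₁ u₂ v v₁ v₂ : ℝ} (hε : ε ^ 2 = 1) (hW : 0 < sqSpeed ε u u₁ v₁) :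
    eulerU lam ε u u₁ u₂ v v₁ v₂ * √(sqSpeed ε u u₁ v₁) ^ 3
      = v₁ * cosh u * eulerNormal lam ε u u₁ u₂ v v₁ v₂ := by
  have hs := (Real.sqrt_pos.mpr hW).ne'
  have hsq := Real.sq_sqrt hW.le
  have hc := (cosh_pos u).ne'
  rw [eulerU, eulerNormal, reducedDet]
  generalize √(sqSpeed ε u u₁ v₁) = s at *
  rw [sqSpeed] at hsq
  simp only [density, densityDeriv, sqSpeedDeriv, sqSpeed]
  field_simp
  simp only [hsq]
  linear_combination v₁ * cosh u * (cosh u * sin v + lam)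
    * (cosh u * (v₁ * u₂ - u₁ * v₂ + v₁ ^ 3 * cosh u * sinh u) - 2 * u₁ ^ 2 * v₁ * sinh u) * hε

lemma eulerV_mul {lam ε u u₁ u₂ v v₁ v₂ : ℝ} (hε : ε ^ 2 = 1) (hW : 0 < sqSpeed ε u u₁ v₁) :
    eulerV lam ε u u₁ u₂ v v₁ v₂ * √(sqSpeed ε u u₁ v₁) ^ 3
      = -(u₁ * cosh u * eulerNormal lam ε u u₁ u₂ v v₁ v₂) := by
  have hs := (Real.sqrt_pos.mpr hW).ne'
  have hsq := Real.sq_sqrt hW.le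
  have hc := (cosh_pos u).ne'
  rw [eulerV, eulerNormal, reducedDet]
  generalize √(sqSpeed ε u u₁ v₁) = s at *
  rw [sqSpeed] at hsq
  simp only [density, densityDeriv, sqSpeedDeriv, sqSpeed]
  field_simp
  have hs4 : s ^ 4 = (ε * (v₁ ^ 2 * cosh u ^ 2 - u₁ ^ 2)) ^ 2 := by rw [← hsq]; ring
  simp only [hs4, hsq]
  linear_combination -u₁ * (cosh u * sin v + lam)
    * (cosh u * (v₁ * u₂ - u₁ * v₂ + v₁ ^ 3 * cosh u * sinh u) - 2 * u₁ ^ 2 * v₁ * sinh u) * hε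

lemma det3_Psi_s10 {u v : ℝ → ℝ} (hu : ContDiff ℝ (⊤ : ℕ∞) u) (hv : ContDiff ℝ (⊤ : ℕ∞) v) (t : ℝ) :
    det3 (Psi (u t) (v t)) (deriv (fun t => Psi (u t) (v t)) t)
        (deriv (deriv fun t => Psi (u t) (v t)) t)
      = cosh (u t) * reducedDet (u t) (deriv u t) (deriv (deriv u) t) (deriv v t)
          (deriv (deriv v) t) := by
  have hu1 : ∀ t, HasDerivAt u (deriv u t) t := fun t => (hu.differentiable (by simp) t).hasDerivAt
  have hv1 : ∀ t, HasDerivAt v (deriv v t) t := fun t => (hv.differentiable (by simp) t).hasDerivAt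
  have hu2 : ∀ t, HasDerivAt (deriv u) (deriv (deriv u) t) t := fun t =>
    ((contDiff_infty_iff_deriv.mp hu).2.differentiable (by simp) t).hasDerivAt
  have hv2 : ∀ t, HasDerivAt (deriv v) (deriv (deriv v) t) t := fun t =>
    ((contDiff_infty_iff_deriv.mp hv).2.differentiable (by simp) t).hasDerivAt
  have h1 : deriv (fun t => Psi (u t) (v t)) = fun t =>
      ![sinh (u t) * deriv u t * cos (v t) + cosh (u t) * (-sin (v t) * deriv v t),
        sinh (u t) * deriv u t * sin (v t) + cosh (u t) * (cos (v t) * deriv v t),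
        cosh (u t) * deriv u t] := by
    funext t
    refine (hasDerivAt_pi.mpr fun i => ?_).deriv
    fin_cases i
    · exact (hu1 t).cosh.mul (hv1 t).cos
    · exact (hu1 t).cosh.mul (hv1 t).sin
    · exact (hu1 t).sinh
  rw [h1]
  have h2 := (hasDerivAt_pi.mpr fun i => (by
    fin_cases i
    · exact (((hu1 t).sinh.mul (hu2 t)).mul (hv1 t).cos).add
        ((hu1 t).cosh.mul ((hv1 t).sin.neg.mul (hv2 t)))
    · exact (((hu1 t).sinh.mul (hu2 t)).mul (hv1 t).sin).add
        ((hu1 t).cosh.mul ((hv1 t).cos.mul (hv2 t)))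
    · exact (hu1 t).cosh.mul (hu2 t) :
    HasDerivAt (fun t => (![sinh (u t) * deriv u t * cos (v t)
          + cosh (u t) * (-sin (v t) * deriv v t),
        sinh (u t) * deriv u t * sin (v t) + cosh (u t) * (cos (v t) * deriv v t),
        cosh (u t) * deriv u t] : Fin 3 → ℝ) i)
      ((![(cosh (u t) * deriv u t * deriv u t + sinh (u t) * deriv (deriv u) t) * cos (v t)
          + sinh (u t) * deriv u t * (-sin (v t) * deriv v t)
          + (sinh (u t) * deriv u t * (-sin (v t) * deriv v t)
            + cosh (u t) * (-(cos (v t) * deriv v t) * deriv v t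
              + -sin (v t) * deriv (deriv v) t)),
        (cosh (u t) * deriv u t * deriv u t + sinh (u t) * deriv (deriv u) t) * sin (v t)
          + sinh (u t) * deriv u t * (cos (v t) * deriv v t)
          + (sinh (u t) * deriv u t * (cos (v t) * deriv v t)
            + cosh (u t) * (-sin (v t) * deriv v t * deriv v t
              + cos (v t) * deriv (deriv v) t)),
        sinh (u t) * deriv u t * deriv u t + cosh (u t) * deriv (deriv u) t] : Fin 3 → ℝ) i) t)).deriv
  rw [h2]
  have hc := (cosh_pos (u t)).ne'
  have hcs := cosh_sq (u t)
  have hsc := sin_sq (v t)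
  simp only [det3, Psi, reducedDet, Matrix.cons_val_zero, Matrix.cons_val_one, Matrix.cons_val]
  field_simp
  generalize cosh (u t) = c at *
  generalize sinh (u t) = h at *
  generalize cos (v t) = C at *
  generalize sin (v t) = S at *
  generalize deriv (deriv u) t = u2 at *
  generalize deriv (deriv v) t = v2 at *
  generalize deriv u t = u1 at *
  generalize deriv v t = v1 at *
  clear h2 hu1 hv1 hu2 hv2 h1
  grind

/-- The first variation of the energy. -/
lemma hasDerivAt_energy {a b lam ε : ℝ} (hab : a ≤ b) {u v φ ψ : ℝ → ℝ}
    (hu : ContDiff ℝ (⊤ : ℕ∞) u) (hv : ContDiff ℝ (⊤ : ℕ∞) v) (hφ : ContDiff ℝ (⊤ : ℕ∞) φ)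
    (hψ : ContDiff ℝ (⊤ : ℕ∞) ψ)
    (hW : ∀ t ∈ Set.Icc a b, 0 < sqSpeed ε (u t) (deriv u t) (deriv v t)) :
    HasDerivAt (fun s => ∫ t in a..b, density lam (u t + s * φ t) (v t + s * ψ t)
        * √(sqSpeed ε (u t + s * φ t) (deriv u t + s * deriv φ t) (deriv v t + s * deriv ψ t)))
      (∫ t in a..b, (densityDeriv (u t) (v t) (φ t) (ψ t)
          * √(sqSpeed ε (u t) (deriv u t) (deriv v t))
        + density lam (u t) (v t) * (sqSpeedDeriv ε (u t) (deriv u t) (deriv v t)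
          (φ t) (deriv φ t) (deriv ψ t) / (2 * √(sqSpeed ε (u t) (deriv u t) (deriv v t)))))) 0 := by
  have cu := hu.continuous
  have cv := hv.continuous
  have cφ := hφ.continuous
  have cψ := hψ.continuous
  have cu' := hu.continuous_deriv (by simp)
  have cv' := hv.continuous_deriv (by simp)
  have cφ' := hφ.continuous_deriv (by simp)
  have cψ' := hψ.continuous_deriv (by simp)
  let W : ℝ × ℝ → ℝ := fun p => sqSpeed ε (u p.2 + p.1 * φ p.2)
    (deriv u p.2 + p.1 * deriv φ p.2) (deriv v p.2 + p.1 * deriv ψ p.2)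
  have cW : Continuous W := by
    simp only [W, sqSpeed]
    fun_prop
  have key := hasDerivAt_intervalIntegral_of_continuousOn
    (F := fun s t => density lam (u t + s * φ t) (v t + s * ψ t) * √(W (s, t)))
    (F' := fun s t => densityDeriv (u t + s * φ t) (v t + s * ψ t) (φ t) (ψ t) * √(W (s, t))
      + density lam (u t + s * φ t) (v t + s * ψ t)
        * (sqSpeedDeriv ε (u t + s * φ t) (deriv u t + s * deriv φ t) (deriv v t + s * deriv ψ t)
            (φ t) (deriv φ t) (deriv ψ t) / (2 * √(W (s, t)))))
    hab (U := {p | 0 < W p}) (isOpen_lt continuous_const cW)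
    (fun t ht => by simpa [W] using hW t ht)
    (by
      simp only [density]
      fun_prop)
    (by
      simp only [density, densityDeriv, sqSpeedDeriv]
      refine ContinuousOn.add (by fun_prop) (ContinuousOn.mul (by fun_prop)
        (ContinuousOn.div (by fun_prop) (by fun_prop) fun p hp => ?_))
      have := Real.sqrt_pos.mpr hp
      positivity)
    (fun s t hst => by
      have hlin : ∀ x y : ℝ, HasDerivAt (fun s : ℝ => x + s * y) y s := fun x y => by
        simpa using ((hasDerivAt_id s).mul_const y).const_add x
      exact (hasDerivAt_density (hlin _ _) (hlin _ _)).mul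
        ((hasDerivAt_sqSpeed (hlin _ _) (hlin _ _) (hlin _ _)).sqrt (ne_of_gt hst)))
  simpa [W] using key


/-- The first variation of the energy in Euler–Lagrange form. -/
lemma hasDerivAt_energy_euler {a b lam ε : ℝ} (hab : a ≤ b) {u v φ ψ : ℝ → ℝ}
    (hu : ContDiff ℝ (⊤ : ℕ∞) u) (hv : ContDiff ℝ (⊤ : ℕ∞) v) (hφ : ContDiff ℝ (⊤ : ℕ∞) φ)
    (hψ : ContDiff ℝ (⊤ : ℕ∞) ψ) (hφa : φ a = 0) (hφb : φ b = 0) (hψa : ψ a = 0) (hψb : ψ b = 0)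
    (hW : ∀ t ∈ Set.Icc a b, 0 < sqSpeed ε (u t) (deriv u t) (deriv v t)) :
    HasDerivAt (fun s => ∫ t in a..b, density lam (u t + s * φ t) (v t + s * ψ t)
        * √(sqSpeed ε (u t + s * φ t) (deriv u t + s * deriv φ t) (deriv v t + s * deriv ψ t)))
      ((∫ t in a..b, eulerU lam ε (u t) (deriv u t) (deriv (deriv u) t)
          (v t) (deriv v t) (deriv (deriv v) t) * φ t)
        + ∫ t in a..b, eulerV lam ε (u t) (deriv u t) (deriv (deriv u) t)
          (v t) (deriv v t) (deriv (deriv v) t) * ψ t) 0 := by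
  have hu' := (contDiff_infty_iff_deriv.mp hu).2
  have hv' := (contDiff_infty_iff_deriv.mp hv).2
  have du : ∀ t, HasDerivAt u (deriv u t) t := fun t => (hu.differentiable (by simp) t).hasDerivAt
  have dv : ∀ t, HasDerivAt v (deriv v t) t := fun t => (hv.differentiable (by simp) t).hasDerivAt
  have du' : ∀ t, HasDerivAt (deriv u) (deriv (deriv u) t) t := fun t =>
    (hu'.differentiable (by simp) t).hasDerivAt
  have dv' : ∀ t, HasDerivAt (deriv v) (deriv (deriv v) t) t := fun t =>
    (hv'.differentiable (by simp) t).hasDerivAt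
  have cu := hu.continuous
  have cv := hv.continuous
  have cu' := hu'.continuous
  have cv' := hv'.continuous
  have cu'' := hu'.continuous_deriv (by simp)
  have cv'' := hv'.continuous_deriv (by simp)
  have cφ := hφ.continuous
  have cψ := hψ.continuous
  have cφ' := hφ.continuous_deriv (by simp)
  have cψ' := hψ.continuous_deriv (by simp)
  let σ : ℝ → ℝ := fun t => √(sqSpeed ε (u t) (deriv u t) (deriv v t))
  have cσ : Continuous σ := by
    simp only [σ, sqSpeed]
    fun_prop
  have hσ : ∀ t ∈ Set.Icc a b, σ t ≠ 0 := fun t ht => (Real.sqrt_pos.mpr (hW t ht)).ne'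
  have hσ3 : ∀ t ∈ Set.Icc a b, 2 * σ t ^ 3 ≠ 0 := fun t ht =>
    mul_ne_zero two_ne_zero (pow_ne_zero 3 (hσ t ht))
  have hX : ∀ t, HasDerivAt (fun t => -ε * deriv u t) (-ε * deriv (deriv u) t) t := fun t =>
    (du' t).const_mul (-ε)
  have hY : ∀ t, HasDerivAt (fun t => ε * deriv v t * cosh (u t) ^ 2)
      (ε * deriv (deriv v) t * cosh (u t) ^ 2
        + ε * deriv v t * (2 * cosh (u t) * sinh (u t) * deriv u t)) t := fun t => by
    refine (((dv' t).const_mul ε).mul ((du t).cosh.pow 2)).congr_deriv ?_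
    simp only [Pi.pow_apply]
    push_cast
    ring
  have hA : ContinuousOn (fun t => sinh (u t) * sin (v t) * σ t + density lam (u t) (v t)
      * (ε * deriv v t ^ 2 * cosh (u t) * sinh (u t)) / σ t) (Set.Icc a b) := by
    simp only [density]
    exact ContinuousOn.add (by fun_prop) (ContinuousOn.div (by fun_prop) (by fun_prop) hσ)
  have hB : ContinuousOn (fun t => cosh (u t) * cos (v t) * σ t) (Set.Icc a b) := by fun_prop
  have hP : ∀ t ∈ Set.Icc a b, HasDerivAt
      (fun t => density lam (u t) (v t) * (-ε * deriv u t) / σ t) _ t := fun t ht =>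
    hasDerivAt_momentum (hasDerivAt_density (du t) (dv t)) (hX t)
      (hasDerivAt_sqSpeed (du t) (du' t) (dv' t)) (hW t ht)
  have hQ : ∀ t ∈ Set.Icc a b, HasDerivAt
      (fun t => density lam (u t) (v t) * (ε * deriv v t * cosh (u t) ^ 2) / σ t) _ t :=
    fun t ht => hasDerivAt_momentum (hasDerivAt_density (du t) (dv t)) (hY t)
      (hasDerivAt_sqSpeed (du t) (du' t) (dv' t)) (hW t ht)
  have hPint := integral_add_mul_deriv_eq hab hA hP (by
    simp only [density, densityDeriv, sqSpeedDeriv]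
    exact ContinuousOn.sub (ContinuousOn.div (by fun_prop) cσ.continuousOn hσ)
      (ContinuousOn.div (by fun_prop) (continuous_const.mul (cσ.pow 3)).continuousOn hσ3)) hφ hφa hφb
  have hQint := integral_add_mul_deriv_eq hab hB hQ (by
    simp only [density, densityDeriv, sqSpeedDeriv]
    exact ContinuousOn.sub (ContinuousOn.div (by fun_prop) cσ.continuousOn hσ)
      (ContinuousOn.div (by fun_prop) (continuous_const.mul (cσ.pow 3)).continuousOn hσ3)) hψ hψa hψb
  refine (hasDerivAt_energy hab hu hv hφ hψ hW).congr_deriv ?_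
  simp only [eulerU, eulerV]
  rw [← hPint, ← hQint, ← intervalIntegral.integral_add]
  · refine intervalIntegral.integral_congr fun t ht => ?_
    rw [Set.uIcc_of_le hab] at ht
    have := hσ t ht
    simp only [densityDeriv, sqSpeedDeriv]
    change _ * σ t + _ * (_ / (2 * σ t)) = _
    field_simp
    ring
  · exact ContinuousOn.intervalIntegrable_of_Icc hab
      ((hA.mul cφ.continuousOn).add ((HasDerivAt.continuousOn hP).mul cφ'.continuousOn))
  · exact ContinuousOn.intervalIntegrable_of_Icc hab
      ((hB.mul cψ.continuousOn).add ((HasDerivAt.continuousOn hQ).mul cψ'.continuousOn))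

/-- The Euler–Lagrange expressions are continuous along a nondegenerate curve. -/
lemma continuousOn_euler {a b lam ε : ℝ} {u v : ℝ → ℝ}
    (hu : ContDiff ℝ (⊤ : ℕ∞) u) (hv : ContDiff ℝ (⊤ : ℕ∞) v)
    (hW : ∀ t ∈ Set.Icc a b, 0 < sqSpeed ε (u t) (deriv u t) (deriv v t)) :
    ContinuousOn (fun t => eulerU lam ε (u t) (deriv u t) (deriv (deriv u) t)
      (v t) (deriv v t) (deriv (deriv v) t)) (Set.Icc a b) ∧
    ContinuousOn (fun t => eulerV lam ε (u t) (deriv u t) (deriv (deriv u) t)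
      (v t) (deriv v t) (deriv (deriv v) t)) (Set.Icc a b) := by
  have hu' := (contDiff_infty_iff_deriv.mp hu).2
  have hv' := (contDiff_infty_iff_deriv.mp hv).2
  have cu := hu.continuous
  have cv := hv.continuous
  have cu' := hu'.continuous
  have cv' := hv'.continuous
  have cu'' := hu'.continuous_deriv (by simp)
  have cv'' := hv'.continuous_deriv (by simp)
  have hσ : ∀ t ∈ Set.Icc a b, √(sqSpeed ε (u t) (deriv u t) (deriv v t)) ≠ 0 :=
    fun t ht => (Real.sqrt_pos.mpr (hW t ht)).ne'
  have hσ3 : ∀ t ∈ Set.Icc a b, 2 * √(sqSpeed ε (u t) (deriv u t) (deriv v t)) ^ 3 ≠ 0 :=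
    fun t ht => mul_ne_zero two_ne_zero (pow_ne_zero 3 (hσ t ht))
  simp only [sqSpeed] at hσ hσ3
  simp only [eulerU, eulerV, density, densityDeriv, sqSpeedDeriv, sqSpeed]
  exact ⟨((Continuous.continuousOn (by fun_prop)).add
      (ContinuousOn.div (by fun_prop) (by fun_prop) hσ)).sub
      ((ContinuousOn.div (by fun_prop) (by fun_prop) hσ).sub
        (ContinuousOn.div (by fun_prop) (by fun_prop) hσ3)),
    (Continuous.continuousOn (by fun_prop)).sub
      ((ContinuousOn.div (by fun_prop) (by fun_prop) hσ).sub
        (ContinuousOn.div (by fun_prop) (by fun_prop) hσ3))⟩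

/-- Both Euler–Lagrange equations hold if and only if their normal component vanishes. -/
lemma euler_eq_zero_iff {lam ε u u₁ u₂ v v₁ v₂ : ℝ} (hε : ε ^ 2 = 1)
    (hW : 0 < sqSpeed ε u u₁ v₁) :
    (eulerU lam ε u u₁ u₂ v v₁ v₂ = 0 ∧ eulerV lam ε u u₁ u₂ v v₁ v₂ = 0) ↔
      eulerNormal lam ε u u₁ u₂ v v₁ v₂ = 0 := by
  have hs := (Real.sqrt_pos.mpr hW).ne'
  have hc := (cosh_pos u).ne'
  have hU := eulerU_mul (lam := lam) (u₂ := u₂) (v := v) (v₂ := v₂) hε hW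
  have hV := eulerV_mul (lam := lam) (u₂ := u₂) (v := v) (v₂ := v₂) hε hW
  constructor
  · rintro ⟨h1, h2⟩
    by_contra hN
    rw [h1, zero_mul, eq_comm] at hU
    rw [h2, zero_mul, eq_comm, neg_eq_zero] at hV
    have hv0 : v₁ = 0 := by simpa [hc, hN] using hU
    have hu0 : u₁ = 0 := by simpa [hc, hN] using hV
    simp [sqSpeed, hv0, hu0] at hW
  · intro hN
    rw [hN, mul_zero] at hU hV
    rw [neg_zero] at hV
    exact ⟨by simpa [hs] using hU, by simpa [hs] using hV⟩

/-- The curvature equation is the vanishing of the normal Euler–Lagrange component. -/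
lemma curvature_eq_iff_s10 {lam ε u u₁ u₂ v v₁ v₂ : ℝ} (hε : ε ^ 2 = 1)
    (hW : 0 < sqSpeed ε u u₁ v₁) (hρ : cosh u * sin v + lam ≠ 0) :
    ε * (cosh u * reducedDet u u₁ u₂ v₁ v₂) / √(sqSpeed ε u u₁ v₁) ^ 3
        = -(u₁ * cos v + v₁ * sinh u * cosh u * sin v)
          / ((cosh u * sin v + lam) * √(sqSpeed ε u u₁ v₁)) ↔
      eulerNormal lam ε u u₁ u₂ v v₁ v₂ = 0 := by
  have hs := (Real.sqrt_pos.mpr hW).ne'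
  have hε0 : ε ≠ 0 := fun h => by simp [h] at hε
  rw [div_eq_div_iff (pow_ne_zero 3 hs) (mul_ne_zero hρ hs), eulerNormal, density]
  nth_rewrite 3 [← Real.sq_sqrt hW.le]
  set s := √(sqSpeed ε u u₁ v₁)
  generalize cosh u * reducedDet u u₁ u₂ v₁ v₂ = D
  constructor
  · intro h
    refine mul_left_cancel₀ (mul_ne_zero hε0 hs) ?_
    linear_combination h + s ^ 3 * (u₁ * cos v + v₁ * sinh u * cosh u * sin v) * hε
  · intro h
    linear_combination ε * s * h - s ^ 3 * (u₁ * cos v + v₁ * sinh u * cosh u * sin v) * hε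

theorem hyperbolic_catenary_characterization
    (a b lam : ℝ) (hab : a < b)
    (u v : ℝ → ℝ) (hu : ContDiff ℝ (⊤ : ℕ∞) u) (hv : ContDiff ℝ (⊤ : ℕ∞) v)
    (ε : ℝ) (hε : ε = 1 ∨ ε = -1)
    (γ : ℝ → Fin 3 → ℝ) (hγ : ∀ t, γ t = Psi (u t) (v t))
    (sp : ℝ → ℝ)
    (hsp : ∀ t, sp t =
      Real.sqrt (ε * ((deriv v t) ^ 2 * Real.cosh (u t) ^ 2 - (deriv u t) ^ 2)))
    (hnd : ∀ t ∈ Set.Icc a b,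
      0 < ε * ((deriv v t) ^ 2 * Real.cosh (u t) ^ 2 - (deriv u t) ^ 2))
    (κ : ℝ → ℝ)
    (hκ : ∀ t, κ t = ε * det3 (γ t) (deriv γ t) (deriv (deriv γ) t) / sp t ^ 3)
    (hd : ∀ t ∈ Set.Icc a b, 0 < Real.cosh (u t) * Real.sin (v t))
    (hne : ∀ t ∈ Set.Icc a b, Real.cosh (u t) * Real.sin (v t) + lam ≠ 0) :
    IsCritical (fun x y => Real.cosh x * Real.sin y + lam) ε u v a b ↔
      ∀ t ∈ Set.Icc a b,
        κ t = -(deriv u t * Real.cos (v t)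
            + deriv v t * Real.sinh (u t) * Real.cosh (u t) * Real.sin (v t))
          / ((Real.cosh (u t) * Real.sin (v t) + lam) * sp t) := by
  have hε2 : ε ^ 2 = 1 := by rcases hε with rfl | rfl <;> norm_num
  have hW : ∀ t ∈ Set.Icc a b, 0 < sqSpeed ε (u t) (deriv u t) (deriv v t) := hnd
  have hcurv : (∀ t ∈ Set.Icc a b,
        κ t = -(deriv u t * Real.cos (v t)
            + deriv v t * Real.sinh (u t) * Real.cosh (u t) * Real.sin (v t))
          / ((Real.cosh (u t) * Real.sin (v t) + lam) * sp t)) ↔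
      ∀ t ∈ Set.Icc a b, eulerU lam ε (u t) (deriv u t) (deriv (deriv u) t)
          (v t) (deriv v t) (deriv (deriv v) t) = 0 ∧
        eulerV lam ε (u t) (deriv u t) (deriv (deriv u) t)
          (v t) (deriv v t) (deriv (deriv v) t) = 0 := by
    refine forall₂_congr fun t ht => ?_
    obtain rfl : γ = fun t => Psi (u t) (v t) := funext hγ
    rw [euler_eq_zero_iff hε2 (hW t ht), ← curvature_eq_iff_s10 hε2 (hW t ht) (hne t ht), hκ t,
      det3_Psi_s10 hu hv, hsp t]
    rfl
  rw [hcurv]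
  constructor
  · intro hcrit t ht
    obtain ⟨cU, cV⟩ := continuousOn_euler (lam := lam) hu hv hW
    have hzero : ContDiff ℝ (⊤ : ℕ∞) (fun _ : ℝ => (0 : ℝ)) := contDiff_const
    refine ⟨eqOn_zero_of_integral_mul_smooth_eq_zero hab cU (fun g hg ha hb => ?_) t ht,
      eqOn_zero_of_integral_mul_smooth_eq_zero hab cV (fun g hg ha hb => ?_) t ht⟩
    · have h := (hasDerivAt_energy_euler (lam := lam) hab.le hu hv hg hzero ha hb rfl rfl hW).deriv
      simpa using h.symm.trans (hcrit g _ hg hzero ha hb rfl rfl)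
    · have h := (hasDerivAt_energy_euler (lam := lam) hab.le hu hv hzero hg rfl rfl ha hb hW).deriv
      simpa using h.symm.trans (hcrit _ g hzero hg rfl rfl ha hb)
  · intro hE φ ψ hφ hψ hφa hφb hψa hψb
    refine (hasDerivAt_energy_euler (lam := lam) hab.le hu hv hφ hψ hφa hφb hψa hψb
      hW).deriv.trans ?_
    have hz : ∀ f g : ℝ → ℝ, (∀ t ∈ Set.Icc a b, f t = 0) → ∫ t in a..b, f t * g t = 0 :=
      fun f g hf => by
        rw [intervalIntegral.integral_congr (g := fun _ => (0 : ℝ)), intervalIntegral.integral_zero]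
        intro t ht
        rw [Set.uIcc_of_le hab.le] at ht
        simp [hf t ht]
    rw [hz _ _ fun t ht => (hE t ht).1, hz _ _ fun t ht => (hE t ht).2, add_zero]
end
end

section
/- (Hyperbolic rotational minimal surfaces.) Let u : ℝ → ℝ be smooth on [a,b] with sin(t) > 0 and ε(cosh(u(t))² − u'(t)²) > 0 for all t ∈ [a,b], |γ'(t)| = √(ε(cosh(u)² − u'²)), let γ(t) = Ψ(u(t), t) with geodesic curvature κ, and let r(t,s) = ( cos(t) cosh(u(t)), sin(t) cosh(u(t)) cos(s), sinh(u(t)), sin(s) sin(t) cosh(u(t)) ) be the associated rotational surface of hyperbolic type in S₁³. Then r is minimal if and only if κ(t) = − ( u'(t) cos(t) + sinh(u(t)) cosh(u(t)) sin(t) ) / ( cosh(u(t)) sin(t) · |γ'(t)| ) for all t ∈ [a,b], i.e. if and only if γ satisfies the catenary equation with respect to the plane {y = 0} with Lagrange multiplier λ = 0. -/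
noncomputable section

open Real

/-- A curve in `ℝ³` is differentiated entrywise. -/
theorem hasDerivAt_vec3_s13 {f₀ f₁ f₂ : ℝ → ℝ} {d₀ d₁ d₂ x : ℝ} (h₀ : HasDerivAt f₀ d₀ x)
    (h₁ : HasDerivAt f₁ d₁ x) (h₂ : HasDerivAt f₂ d₂ x) :
    HasDerivAt (fun y => ![f₀ y, f₁ y, f₂ y]) ![d₀, d₁, d₂] x := by
  rw [hasDerivAt_pi]
  intro i
  fin_cases i <;> simpa

/-- A curve in `ℝ⁴` is differentiated entrywise. -/
theorem hasDerivAt_vec4_s13 {f₀ f₁ f₂ f₃ : ℝ → ℝ} {d₀ d₁ d₂ d₃ x : ℝ} (h₀ : HasDerivAt f₀ d₀ x)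
    (h₁ : HasDerivAt f₁ d₁ x) (h₂ : HasDerivAt f₂ d₂ x) (h₃ : HasDerivAt f₃ d₃ x) :
    HasDerivAt (fun y => ![f₀ y, f₁ y, f₂ y, f₃ y]) ![d₀, d₁, d₂, d₃] x := by
  rw [hasDerivAt_pi]
  intro i
  fin_cases i <;> simpa

/-- The Lorentzian Gram determinant of two triples sharing the first two vectors. -/
theorem det3_mul_det3 (a b v w : Fin 3 → ℝ) :
    det3 a b v * det3 a b w =
      -(lprod a a * (lprod b b * lprod v w - lprod b w * lprod v b)
        - lprod a b * (lprod a b * lprod v w - lprod b w * lprod v a)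
        + lprod a w * (lprod a b * lprod v b - lprod b b * lprod v a)) := by
  simp only [det3, lprod]
  ring

/-- If `a` is a unit vector orthogonal to the non-null vector `b`, then `w` lies in their span
iff it is orthogonal to every vector orthogonal to both. -/
theorem det3_eq_zero_iff {a b w : Fin 3 → ℝ} (haa : lprod a a = 1) (hab : lprod a b = 0)
    (hbb : lprod b b ≠ 0) :
    det3 a b w = 0 ↔ ∀ v, lprod v a = 0 → lprod v b = 0 → lprod v w = 0 := by
  constructor
  · intro h v hva hvb
    have key := det3_mul_det3 a b v w
    rw [h, hva, hvb, haa, hab] at key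
    have : lprod b b * lprod v w = 0 := by linarith
    exact (mul_eq_zero.mp this).resolve_left hbb
  · intro h
    have := h ![a 1 * b 2 - a 2 * b 1, a 2 * b 0 - a 0 * b 2, -(a 0 * b 1 - a 1 * b 0)]
      (by simp [lprod]; ring) (by simp [lprod]; ring)
    simp only [lprod, Matrix.cons_val_zero, Matrix.cons_val_one, Matrix.cons_val] at this
    rw [← this, det3]
    ring

theorem hyperbolic_rotational_minimal
    (a b : ℝ) (hab : a < b)
    (u : ℝ → ℝ) (hu : ContDiff ℝ (⊤ : ℕ∞) u)
    (ε : ℝ) (hε : ε = 1 ∨ ε = -1)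
    (sp : ℝ → ℝ)
    (hsp : ∀ t, sp t = Real.sqrt (ε * (Real.cosh (u t) ^ 2 - (deriv u t) ^ 2)))
    (hpos : ∀ t ∈ Set.Icc a b, 0 < Real.sin t)
    (hnd : ∀ t ∈ Set.Icc a b, 0 < ε * (Real.cosh (u t) ^ 2 - (deriv u t) ^ 2))
    (γ : ℝ → Fin 3 → ℝ) (hγ : ∀ t, γ t = Psi (u t) t)
    (κ : ℝ → ℝ)
    (hκ : ∀ t, κ t = ε * det3 (γ t) (deriv γ t) (deriv (deriv γ) t) / sp t ^ 3)
    (r : ℝ → ℝ → Fin 4 → ℝ)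
    (hr : ∀ t s, r t s = ![Real.cos t * Real.cosh (u t),
      Real.sin t * Real.cosh (u t) * Real.cos s, Real.sinh (u t),
      Real.sin s * Real.sin t * Real.cosh (u t)])
    :
    ((∀ t ∈ Set.Icc a b, ∀ s : ℝ, ∀ N : Fin 4 → ℝ,
        B4 N (r t s) = 0 → B4 N (deriv (fun τ => r τ s) t) = 0 →
          B4 N (deriv (r t) s) = 0 →
        B4 (deriv (fun τ => r τ s) t) (deriv (fun τ => r τ s) t)
            * B4 N (deriv (deriv (r t)) s)
          - 2 * B4 (deriv (fun τ => r τ s) t) (deriv (r t) s)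
            * B4 N (deriv (fun σ => deriv (fun τ => r τ σ) t) s)
          + B4 (deriv (r t) s) (deriv (r t) s)
            * B4 N (deriv (deriv (fun τ => r τ s)) t) = 0)
      ↔ (∀ t ∈ Set.Icc a b, κ t = -(deriv u t * Real.cos t + Real.sinh (u t) * Real.cosh (u t) * Real.sin t) / (Real.cosh (u t) * Real.sin t * sp t))) := by
  have hu1 : ∀ t, HasDerivAt u (deriv u t) t := fun t =>
    (hu.differentiable (by simp) t).hasDerivAt
  have hu2 : ∀ t, HasDerivAt (deriv u) (deriv (deriv u) t) t := fun t =>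
    ((contDiff_infty_iff_deriv.mp hu).2.differentiable (by simp) t).hasDerivAt
  generalize deriv u = p at *
  generalize deriv p = q at *
  have hC : ∀ t, HasDerivAt (fun t => cosh (u t)) (sinh (u t) * p t) t := fun t => (hu1 t).cosh
  have hS : ∀ t, HasDerivAt (fun t => sinh (u t)) (cosh (u t) * p t) t := fun t => (hu1 t).sinh
  obtain ⟨x1, hx1⟩ : ∃ f : ℝ → ℝ, f = fun t => -sin t * cosh (u t) + cos t * (sinh (u t) * p t) :=
    ⟨_, rfl⟩
  obtain ⟨y1, hy1⟩ : ∃ f : ℝ → ℝ, f = fun t => cos t * cosh (u t) + sin t * (sinh (u t) * p t) :=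
    ⟨_, rfl⟩
  obtain ⟨z1, hz1⟩ : ∃ f : ℝ → ℝ, f = fun t => cosh (u t) * p t := ⟨_, rfl⟩
  obtain ⟨x2, hx2⟩ : ∃ f : ℝ → ℝ, f = fun t =>
      (-cos t * cosh (u t) + -sin t * (sinh (u t) * p t)) + (-sin t * (sinh (u t) * p t)
        + cos t * (cosh (u t) * p t * p t + sinh (u t) * q t)) := ⟨_, rfl⟩
  obtain ⟨y2, hy2⟩ : ∃ f : ℝ → ℝ, f = fun t =>
      (-sin t * cosh (u t) + cos t * (sinh (u t) * p t)) + (cos t * (sinh (u t) * p t)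
        + sin t * (cosh (u t) * p t * p t + sinh (u t) * q t)) := ⟨_, rfl⟩
  obtain ⟨z2, hz2⟩ : ∃ f : ℝ → ℝ, f = fun t => sinh (u t) * p t * p t + cosh (u t) * q t :=
    ⟨_, rfl⟩
  have hX : ∀ t, HasDerivAt (fun t => cos t * cosh (u t)) (x1 t) t := fun t => by
    rw [hx1]; exact (hasDerivAt_cos t).mul (hC t)
  have hY : ∀ t, HasDerivAt (fun t => sin t * cosh (u t)) (y1 t) t := fun t => by
    rw [hy1]; exact (hasDerivAt_sin t).mul (hC t)
  have hZ : ∀ t, HasDerivAt (fun t => sinh (u t)) (z1 t) t := fun t => by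
    rw [hz1]; exact hS t
  have hX1 : ∀ t, HasDerivAt x1 (x2 t) t := fun t => by
    rw [hx1, hx2]
    exact ((hasDerivAt_sin t).neg.mul (hC t)).add ((hasDerivAt_cos t).mul ((hS t).mul (hu2 t)))
  have hY1 : ∀ t, HasDerivAt y1 (y2 t) t := fun t => by
    rw [hy1, hy2]
    exact ((hasDerivAt_cos t).mul (hC t)).add ((hasDerivAt_sin t).mul ((hS t).mul (hu2 t)))
  have hZ1 : ∀ t, HasDerivAt z1 (z2 t) t := fun t => by
    rw [hz1, hz2]; exact (hC t).mul (hu2 t)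
  have eγ : γ = fun t => ![cos t * cosh (u t), sin t * cosh (u t), sinh (u t)] := by
    funext t; rw [hγ, Psi, mul_comm, mul_comm (sin t)]
  have eγ1 : deriv γ = fun t => ![x1 t, y1 t, z1 t] := by
    rw [eγ]; funext t; exact (hasDerivAt_vec3_s13 (hX t) (hY t) (hZ t)).deriv
  have eγ2 : deriv (deriv γ) = fun t => ![x2 t, y2 t, z2 t] := by
    rw [eγ1]; funext t; exact (hasDerivAt_vec3_s13 (hX1 t) (hY1 t) (hZ1 t)).deriv
  have er : ∀ s, (fun τ => r τ s) = fun t =>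
      ![cos t * cosh (u t), sin t * cosh (u t) * cos s, sinh (u t),
        sin t * cosh (u t) * sin s] := fun s => by
    funext t; rw [hr, mul_assoc (sin s), mul_comm (sin s)]
  have ert : ∀ s, deriv (fun τ => r τ s) = fun t =>
      ![x1 t, y1 t * cos s, z1 t, y1 t * sin s] := fun s => by
    rw [er]; funext t
    exact (hasDerivAt_vec4_s13 (hX t) ((hY t).mul_const _) (hZ t) ((hY t).mul_const _)).deriv
  have ertt : ∀ s, deriv (deriv (fun τ => r τ s)) = fun t =>
      ![x2 t, y2 t * cos s, z2 t, y2 t * sin s] := fun s => by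
    rw [ert]; funext t
    exact (hasDerivAt_vec4_s13 (hX1 t) ((hY1 t).mul_const _) (hZ1 t) ((hY1 t).mul_const _)).deriv
  have er' : ∀ t, r t = fun s =>
      ![cos t * cosh (u t), sin t * cosh (u t) * cos s, sinh (u t),
        sin t * cosh (u t) * sin s] := fun t => by
    funext s; exact congrFun (er s) t
  have ers : ∀ t, deriv (r t) = fun s =>
      ![0, sin t * cosh (u t) * -sin s, 0, sin t * cosh (u t) * cos s] := fun t => by
    rw [er']; funext s
    exact (hasDerivAt_vec4_s13 (hasDerivAt_const _ _) ((hasDerivAt_cos s).const_mul _)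
      (hasDerivAt_const _ _) ((hasDerivAt_sin s).const_mul _)).deriv
  have erss : ∀ t, deriv (deriv (r t)) = fun s =>
      ![0, sin t * cosh (u t) * -cos s, 0, sin t * cosh (u t) * -sin s] := fun t => by
    rw [ers]; funext s
    exact (hasDerivAt_vec4_s13 (hasDerivAt_const _ _) ((hasDerivAt_sin s).neg.const_mul _)
      (hasDerivAt_const _ _) ((hasDerivAt_cos s).const_mul _)).deriv
  refine forall₂_congr fun t ht => ?_
  have hσ := hpos t ht
  have hE := hnd t ht
  have hCpos := cosh_pos (u t)
  have hy : 0 < sin t * cosh (u t) := mul_pos hσ hCpos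
  have hsp0 : 0 < sp t := by rw [hsp]; exact sqrt_pos.mpr hE
  have hsp2 : sp t ^ 2 = ε * (cosh (u t) ^ 2 - p t ^ 2) := by rw [hsp, sq_sqrt hE.le]
  have hε2 : ε ^ 2 = 1 := by rcases hε with h | h <;> rw [h] <;> norm_num
  have hcs := sin_sq_add_cos_sq t
  have hch := cosh_sq (u t)
  have hγγ : lprod (γ t) (γ t) = 1 := by
    simp only [eγ, lprod, Matrix.cons_val_zero, Matrix.cons_val_one, Matrix.cons_val]
    linear_combination cosh (u t) ^ 2 * hcs + hch
  have hγγ1 : lprod (γ t) (deriv γ t) = 0 := by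
    simp only [eγ1]
    simp only [eγ, lprod, Matrix.cons_val_zero, Matrix.cons_val_one, Matrix.cons_val, hx1,
      hy1, hz1]
    linear_combination cosh (u t) * sinh (u t) * p t * hcs
  have hγ11 : lprod (deriv γ t) (deriv γ t) = cosh (u t) ^ 2 - p t ^ 2 := by
    simp only [eγ1, lprod, Matrix.cons_val_zero, Matrix.cons_val_one, Matrix.cons_val, hx1,
      hy1, hz1]
    linear_combination (cosh (u t) ^ 2 + sinh (u t) ^ 2 * p t ^ 2) * hcs - p t ^ 2 * hch
  set E := cosh (u t) ^ 2 - p t ^ 2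
  have hE0 : E ≠ 0 := by rintro h; simp [h] at hE
  -- `w` is the acceleration of the profile curve, corrected by that of the orbits of the rotation.
  set w : Fin 3 → ℝ := ![sin t * cosh (u t) * x2 t, sin t * cosh (u t) * y2 t - E,
    sin t * cosh (u t) * z2 t] with hw
  have hdet : det3 (γ t) (deriv γ t) w =
      sin t * cosh (u t) * det3 (γ t) (deriv γ t) (deriv (deriv γ) t)
        + E * (p t * cos t + sinh (u t) * cosh (u t) * sin t) := by
    simp only [eγ2]
    simp only [eγ1]
    simp only [eγ, det3, hw, Matrix.cons_val_zero, Matrix.cons_val_one, Matrix.cons_val]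
    simp only [hx1, hz1]
    linear_combination E * p t * cos t * hch
  have hκiff : κ t = -(p t * cos t + sinh (u t) * cosh (u t) * sin t)
      / (cosh (u t) * sin t * sp t) ↔ det3 (γ t) (deriv γ t) w = 0 := by
    rw [hdet, hκ, div_eq_div_iff (by positivity) (by positivity)]
    generalize det3 (γ t) (deriv γ t) (deriv (deriv γ) t) = D
    constructor
    · intro h
      have h' : ε * sp t * (sin t * cosh (u t) * D
          + E * (p t * cos t + sinh (u t) * cosh (u t) * sin t)) = 0 := by
        linear_combination h - sp t * (p t * cos t + sinh (u t) * cosh (u t) * sin t) * hsp2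
      have hεsp : ε * sp t ≠ 0 := mul_ne_zero (by rintro rfl; norm_num at hε2) hsp0.ne'
      exact (mul_eq_zero.mp h').resolve_left hεsp
    · intro h
      linear_combination ε * sp t * h
        + sp t * (p t * cos t + sinh (u t) * cosh (u t) * sin t) * hsp2
  rw [hκiff, det3_eq_zero_iff hγγ hγγ1 (by rw [hγ11]; exact hE0)]
  simp only [eγ1] at hγ11 ⊢
  simp only [lprod, eγ, Matrix.cons_val_zero, Matrix.cons_val_one, Matrix.cons_val, hw]
    at hγ11 ⊢
  constructor
  · intro h v hv hv1
    have := h 0 ![v 0, v 1, v 2, 0]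
    simp only [ertt, erss] at this
    simp only [ert, ers] at this
    simp only [er', B4, Matrix.cons_val_zero, Matrix.cons_val_one,
      Matrix.cons_val, sin_zero, cos_zero] at this
    have := this (by linear_combination hv) (by linear_combination hv1) (by ring)
    refine (mul_eq_zero.mp ?_).resolve_left hy.ne'
    linear_combination this + sin t * cosh (u t) * v 1 * hγ11
  · intro h s N hN hN1 _
    have hss := sin_sq_add_cos_sq s
    have hF : B4 (deriv (fun τ => r τ s) t) (deriv (r t) s) = 0 := by
      simp only [ert, ers, B4, Matrix.cons_val_zero, Matrix.cons_val_one, Matrix.cons_val]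
      ring
    rw [hF]
    simp only [ertt, erss]
    simp only [ert, ers] at hN1 ⊢
    simp only [er', B4, Matrix.cons_val_zero, Matrix.cons_val_one,
      Matrix.cons_val] at hN hN1 ⊢
    have := h ![N 0, N 1 * cos s + N 3 * sin s, N 2]
    simp only [Matrix.cons_val_zero, Matrix.cons_val_one, Matrix.cons_val] at this
    have := this (by linear_combination hN) (by linear_combination hN1)
    have hEE : x1 t * x1 t + y1 t * cos s * (y1 t * cos s) - z1 t * z1 t
        + y1 t * sin s * (y1 t * sin s) = E := by
      linear_combination hγ11 + y1 t ^ 2 * hss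
    have hG : sin t * cosh (u t) * -sin s * (sin t * cosh (u t) * -sin s)
        + sin t * cosh (u t) * cos s * (sin t * cosh (u t) * cos s) = (sin t * cosh (u t)) ^ 2 := by
      linear_combination (sin t * cosh (u t)) ^ 2 * hss
    simp only [mul_zero, zero_mul, zero_add, sub_zero]
    rw [hEE, hG]
    linear_combination sin t * cosh (u t) * this
end
end
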